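/- arXiv:1108.4552 — 11 statements merged into one kernel-verified Lean document; each statement's English description precedes it below -/
import Mathlib

section
/- For all x, v ∈ ℝ^d and every λ ∈ ℝ \ {ε₁a₁, …, ε_d a_d}, the following identity holds: (Σ_{i=1}^d x_i v_i/(a_i − ε_i λ))² − (Σ_{i=1}^d v_i²/(a_i − ε_i λ)) · (Σ_{i=1}^d x_i²/(a_i − ε_i λ) − 1) = Σ_{i=1}^d ε_i F_i(x,v)/(a_i − ε_i λ) = P_{x,v}(λ) / ∏_{i=1}^d (a_i − ε_i λ). In particular, the line {x + t v : t ∈ ℝ} is tangent to the quadric Q_λ (the quadratic equation in t, Σ_{i=1}^d (x_i + t v_i)²/(a_i − ε_i λ) = 1, has a double root) exactly when P_{x,v}(λ) = 0. -/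
open Polynomial

/-- The polynomial P_{x,v}(λ) = Σ_{i=1}^d ε_i F_i(x,v) ∏_{j≠i} (a_j − ε_j λ), where
F_i(x,v) = ε_i v_i² + Σ_{j≠i} (x_i v_j − x_j v_i)²/(ε_j a_i − ε_i a_j). -/
noncomputable def Ppoly (d : ℕ) (a ε x v : ℕ → ℝ) : Polynomial ℝ :=
  ∑ i ∈ Finset.Icc 1 d,
    Polynomial.C (ε i * (ε i * v i ^ 2 +
      ∑ j ∈ (Finset.Icc 1 d).erase i,
        (x i * v j - x j * v i) ^ 2 / (ε j * a i - ε i * a j))) *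
    ∏ j ∈ (Finset.Icc 1 d).erase i,
      (Polynomial.C (a j) - Polynomial.C (ε j) * Polynomial.X)

theorem sum_sum_add_swap {ι : Type*} (s : Finset ι) (f : ι → ι → ℝ) :
    2 * ∑ i ∈ s, ∑ j ∈ s, f i j = ∑ i ∈ s, ∑ j ∈ s, (f i j + f j i) := by
  simp only [Finset.sum_add_distrib]
  rw [Finset.sum_comm (f := fun i j => f j i), two_mul]

theorem weighted_lagrange_identity {ι : Type*} (s : Finset ι) (x v b : ι → ℝ) :
    2 * ((∑ i ∈ s, x i * v i / b i) ^ 2 - (∑ i ∈ s, v i ^ 2 / b i) * ∑ i ∈ s, x i ^ 2 / b i)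
      = ∑ i ∈ s, ∑ j ∈ s, -((x i * v j - x j * v i) ^ 2 / (b i * b j)) := by
  rw [sq, Finset.sum_mul_sum, Finset.sum_mul_sum, ← Finset.sum_sub_distrib]
  simp only [← Finset.sum_sub_distrib]
  rw [sum_sum_add_swap]
  refine Finset.sum_congr rfl fun i _ => Finset.sum_congr rfl fun j _ => ?_
  simp only [div_eq_mul_inv, mul_inv]
  ring

theorem discriminant_eq_sum_integrals {ι : Type*} [DecidableEq ι] (s : Finset ι)
    (a ε x v : ι → ℝ) (lam : ℝ) (hε : ∀ i ∈ s, ε i * ε i = 1)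
    (hne : ∀ i ∈ s, ∀ j ∈ s, i ≠ j → ε j * a i - ε i * a j ≠ 0)
    (hlam : ∀ i ∈ s, a i - ε i * lam ≠ 0) :
    (∑ i ∈ s, x i * v i / (a i - ε i * lam)) ^ 2 -
        (∑ i ∈ s, v i ^ 2 / (a i - ε i * lam)) * ((∑ i ∈ s, x i ^ 2 / (a i - ε i * lam)) - 1)
      = ∑ i ∈ s, (ε i * (ε i * v i ^ 2 + ∑ j ∈ s.erase i,
          (x i * v j - x j * v i) ^ 2 / (ε j * a i - ε i * a j))) / (a i - ε i * lam) := by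
  have hterm : ∀ i ∈ s, (ε i * (ε i * v i ^ 2 + ∑ j ∈ s.erase i,
      (x i * v j - x j * v i) ^ 2 / (ε j * a i - ε i * a j))) / (a i - ε i * lam)
      = v i ^ 2 / (a i - ε i * lam) + ∑ j ∈ s, ε i * ((x i * v j - x j * v i) ^ 2 /
          (ε j * a i - ε i * a j)) / (a i - ε i * lam) := by
    intro i hi
    rw [Finset.sum_erase s (by simp [mul_comm]), mul_add, add_div, ← mul_assoc, hε i hi, one_mul,
      Finset.mul_sum, Finset.sum_div]
  rw [Finset.sum_congr rfl hterm, Finset.sum_add_distrib]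
  have hswap := sum_sum_add_swap s fun i j => ε i * ((x i * v j - x j * v i) ^ 2 /
    (ε j * a i - ε i * a j)) / (a i - ε i * lam)
  have hpair : ∑ i ∈ s, ∑ j ∈ s, (ε i * ((x i * v j - x j * v i) ^ 2 /
        (ε j * a i - ε i * a j)) / (a i - ε i * lam) + ε j * ((x j * v i - x i * v j) ^ 2 /
        (ε i * a j - ε j * a i)) / (a j - ε j * lam))
      = ∑ i ∈ s, ∑ j ∈ s,
        -((x i * v j - x j * v i) ^ 2 / ((a i - ε i * lam) * (a j - ε j * lam))) := by
    refine Finset.sum_congr rfl fun i hi => Finset.sum_congr rfl fun j hj => ?_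
    rcases eq_or_ne i j with rfl | hij
    · simp [mul_comm]
    · have h₁ := hlam i hi
      have h₂ := hlam j hj
      have h₃ := hne i hi j hj hij
      rw [← neg_sub (ε j * a i) (ε i * a j)]
      have hD : ε j * a i - ε i * a j
          = ε j * (a i - ε i * lam) - ε i * (a j - ε j * lam) := by ring
      rw [hD] at h₃ ⊢
      generalize a i - ε i * lam = p at h₁ h₃ ⊢
      generalize a j - ε j * lam = q at h₂ h₃ ⊢
      field_simp
      ring
  have hlag := weighted_lagrange_identity s x v fun i => a i - ε i * lam
  linarith

theorem sum_div_eq_sum_mul_prod_erase_div {ι K : Type*} [DecidableEq ι] [Field K] (s : Finset ι)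
    (c b : ι → K) (hb : ∀ i ∈ s, b i ≠ 0) :
    ∑ i ∈ s, c i / b i = (∑ i ∈ s, c i * ∏ j ∈ s.erase i, b j) / ∏ i ∈ s, b i := by
  rw [Finset.sum_div]
  refine Finset.sum_congr rfl fun i hi => ?_
  have hprod : ∏ j ∈ s.erase i, b j ≠ 0 :=
    Finset.prod_ne_zero_iff.2 fun j hj => hb j (Finset.mem_of_mem_erase hj)
  rw [← Finset.mul_prod_erase s b hi, mul_div_mul_right _ _ hprod]

theorem signed_axes_separated {k l d : ℕ} (hd : d = k + l) {a ε : ℕ → ℝ}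
    (hε1 : ∀ i ∈ Finset.Icc 1 k, ε i = 1) (hε2 : ∀ i ∈ Finset.Icc (k + 1) d, ε i = -1)
    (hapos : ∀ i ∈ Finset.Icc 1 d, 0 < a i)
    (hadec : ∀ i, 1 ≤ i → i < k → a (i + 1) < a i)
    (hainc : ∀ i, k + 1 ≤ i → i < d → a i < a (i + 1))
    {i j : ℕ} (hi : i ∈ Finset.Icc 1 d) (hj : j ∈ Finset.Icc 1 d) (hij : i < j) :
    ε j * a i - ε i * a j ≠ 0 := by
  have hai := hapos i hi
  have haj := hapos j hj
  rw [Finset.mem_Icc] at hi hj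
  by_cases hjk : j ≤ k
  · have hlt : a j < a i := by
      have hanti : StrictAntiOn a (Set.Icc 1 k) :=
        strictAntiOn_of_add_one_lt Set.ordConnected_Icc fun m _ hm hm' => hadec m hm.1 hm'.2
      exact hanti ⟨hi.1, by omega⟩ ⟨hj.1, hjk⟩ hij
    rw [hε1 i (by simp; omega), hε1 j (by simp; omega)]
    linarith
  · by_cases hik : i ≤ k
    · rw [hε1 i (by simp; omega), hε2 j (by simp; omega)]
      linarith
    · have hlt : a i < a j := by
        have hmono : StrictMonoOn a (Set.Icc (k + 1) d) :=
          strictMonoOn_of_lt_add_one Set.ordConnected_Icc fun m _ hm hm' => hainc m hm.1 hm'.2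
        exact hmono ⟨by omega, hi.2⟩ ⟨by omega, hj.2⟩ hij
      rw [hε2 i (by simp; omega), hε2 j (by simp; omega)]
      linarith

/- STATEMENT 3: the discriminant identity
(Σ x_i v_i/(a_i−ε_iλ))² − (Σ v_i²/(a_i−ε_iλ))·(Σ x_i²/(a_i−ε_iλ) − 1)
  = Σ ε_i F_i/(a_i−ε_iλ) = P_{x,v}(λ)/∏(a_i−ε_iλ),
valid for λ avoiding the values ε_i a_i; in particular the quadratic in t,
Σ (x_i+t v_i)²/(a_i−ε_iλ) = 1, has a double root (vanishing discriminant)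
exactly when P_{x,v}(λ) = 0. -/
theorem stmt3 (k l d : ℕ) (hk : 1 ≤ k) (hl : 1 ≤ l) (hd : d = k + l)
    (a ε : ℕ → ℝ)
    (hε1 : ∀ i ∈ Finset.Icc 1 k, ε i = 1)
    (hε2 : ∀ i ∈ Finset.Icc (k + 1) d, ε i = -1)
    (hapos : ∀ i ∈ Finset.Icc 1 d, 0 < a i)
    (hadec : ∀ i, 1 ≤ i → i < k → a (i + 1) < a i)
    (hainc : ∀ i, k + 1 ≤ i → i < d → a i < a (i + 1))
    (x v : ℕ → ℝ)
    (lam : ℝ) (hlam : ∀ i ∈ Finset.Icc 1 d, a i - ε i * lam ≠ 0) :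
    ((∑ i ∈ Finset.Icc 1 d, x i * v i / (a i - ε i * lam)) ^ 2 -
        (∑ i ∈ Finset.Icc 1 d, v i ^ 2 / (a i - ε i * lam)) *
          ((∑ i ∈ Finset.Icc 1 d, x i ^ 2 / (a i - ε i * lam)) - 1)
      = ∑ i ∈ Finset.Icc 1 d,
          (ε i * (ε i * v i ^ 2 +
            ∑ j ∈ (Finset.Icc 1 d).erase i,
              (x i * v j - x j * v i) ^ 2 / (ε j * a i - ε i * a j))) /
            (a i - ε i * lam)) ∧
    ((∑ i ∈ Finset.Icc 1 d,
          (ε i * (ε i * v i ^ 2 +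
            ∑ j ∈ (Finset.Icc 1 d).erase i,
              (x i * v j - x j * v i) ^ 2 / (ε j * a i - ε i * a j))) /
            (a i - ε i * lam))
      = (Ppoly d a ε x v).eval lam / ∏ i ∈ Finset.Icc 1 d, (a i - ε i * lam)) ∧
    (((2 * ∑ i ∈ Finset.Icc 1 d, x i * v i / (a i - ε i * lam)) ^ 2 -
        4 * (∑ i ∈ Finset.Icc 1 d, v i ^ 2 / (a i - ε i * lam)) *
          ((∑ i ∈ Finset.Icc 1 d, x i ^ 2 / (a i - ε i * lam)) - 1) = 0) ↔
      (Ppoly d a ε x v).eval lam = 0) := by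
  have hε : ∀ i ∈ Finset.Icc 1 d, ε i * ε i = 1 := by
    intro i hi
    rw [Finset.mem_Icc] at hi
    rcases le_or_gt i k with hik | hik
    · simp [hε1 i (Finset.mem_Icc.2 ⟨hi.1, hik⟩)]
    · simp [hε2 i (Finset.mem_Icc.2 ⟨hik, hi.2⟩)]
  have hne : ∀ i ∈ Finset.Icc 1 d, ∀ j ∈ Finset.Icc 1 d, i ≠ j →
      ε j * a i - ε i * a j ≠ 0 := by
    intro i hi j hj hij
    rcases hij.lt_or_gt with h | h
    · exact signed_axes_separated hd hε1 hε2 hapos hadec hainc hi hj h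
    · rw [← neg_sub]
      exact neg_ne_zero.2 (signed_axes_separated hd hε1 hε2 hapos hadec hainc hj hi h)
  have hdisc := discriminant_eq_sum_integrals (Finset.Icc 1 d) a ε x v lam hε hne hlam
  have heval : (∑ i ∈ Finset.Icc 1 d, (ε i * (ε i * v i ^ 2 + ∑ j ∈ (Finset.Icc 1 d).erase i,
        (x i * v j - x j * v i) ^ 2 / (ε j * a i - ε i * a j))) / (a i - ε i * lam))
      = (Ppoly d a ε x v).eval lam / ∏ i ∈ Finset.Icc 1 d, (a i - ε i * lam) := by
    rw [sum_div_eq_sum_mul_prod_erase_div _ _ _ hlam, Ppoly, eval_finsetSum]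
    simp only [eval_mul, eval_C, eval_prod, eval_sub, eval_X]
  refine ⟨hdisc, heval, ?_⟩
  have hprod : ∏ i ∈ Finset.Icc 1 d, (a i - ε i * lam) ≠ 0 := Finset.prod_ne_zero_iff.2 hlam
  rw [mul_pow, mul_assoc, show (2 : ℝ) ^ 2 = 4 by norm_num, ← mul_sub, hdisc, heval]
  simp [hprod]
end

section
/- For all x, v ∈ ℝ^d: Σ_{i=1}^d F_i(x, v) = ⟨v, v⟩. Consequently, the coefficient of λ^{d−1} in the polynomial P_{x,v}(λ) equals (−1)^{d−1+l} · ⟨v, v⟩; in particular, deg P_{x,v} ≤ d−2 if and only if v is light-like (⟨v,v⟩ = 0). -/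
open Polynomial

/-- The sum of an antisymmetric function over all ordered pairs of distinct elements vanishes. -/
theorem sum_sum_erase_eq_zero_of_antisymm (s : Finset ℕ) (g : ℕ → ℕ → ℝ)
    (hg : ∀ i j, g j i = -g i j) : ∑ i ∈ s, ∑ j ∈ s.erase i, g i j = 0 := by
  have hdiag : ∀ i, g i i = 0 := fun i => by linarith [hg i i]
  have herase : ∀ i ∈ s, ∑ j ∈ s.erase i, g i j = ∑ j ∈ s, g i j := fun i _ =>
    Finset.sum_erase s (hdiag i)
  rw [Finset.sum_congr rfl herase]
  have hcomm : ∑ i ∈ s, ∑ j ∈ s, g i j = -∑ i ∈ s, ∑ j ∈ s, g i j := by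
    conv_lhs => rw [Finset.sum_comm]
    simp only [← Finset.sum_neg_distrib]
    exact Finset.sum_congr rfl fun i _ => Finset.sum_congr rfl fun j _ => hg i j
  linarith

theorem natDegree_C_sub_C_mul_X_le (b c : ℝ) : (C b - C c * X).natDegree ≤ 1 := by
  compute_degree

theorem natDegree_prod_C_sub_C_mul_X_le (s : Finset ℕ) (a ε : ℕ → ℝ) :
    (∏ j ∈ s, (C (a j) - C (ε j) * X)).natDegree ≤ s.card := by
  refine (natDegree_prod_le _ _).trans ?_
  simpa using Finset.sum_le_card_nsmul s _ 1 fun j _ => natDegree_C_sub_C_mul_X_le (a j) (ε j)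

theorem coeff_card_prod_C_sub_C_mul_X (s : Finset ℕ) (a ε : ℕ → ℝ) :
    (∏ j ∈ s, (C (a j) - C (ε j) * X)).coeff s.card = (-1) ^ s.card * ∏ j ∈ s, ε j := by
  have h := coeff_prod_of_natDegree_le s (fun j => C (a j) - C (ε j) * X) 1
    fun j _ => natDegree_C_sub_C_mul_X_le (a j) (ε j)
  rw [mul_one] at h
  rw [h, ← Finset.prod_const, ← Finset.prod_mul_distrib]
  refine Finset.prod_congr rfl fun j _ => ?_
  simp [coeff_C]

theorem natDegree_Ppoly_le (d : ℕ) (a ε x v : ℕ → ℝ) :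
    (Ppoly d a ε x v).natDegree ≤ d - 1 := by
  refine natDegree_sum_le_of_forall_le _ _ fun i hi => ?_
  refine (natDegree_C_mul_le _ _).trans ((natDegree_prod_C_sub_C_mul_X_le _ a ε).trans ?_)
  simp [Finset.card_erase_of_mem hi]

/-- The coefficient of `X ^ (d - 1)` in `Ppoly`, for arbitrary weights `ε`. -/
theorem coeff_Ppoly (d : ℕ) (a ε x v : ℕ → ℝ) :
    (Ppoly d a ε x v).coeff (d - 1) =
      (-1) ^ (d - 1) * (∏ j ∈ Finset.Icc 1 d, ε j) * ∑ i ∈ Finset.Icc 1 d,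
        (ε i * v i ^ 2 + ∑ j ∈ (Finset.Icc 1 d).erase i,
          (x i * v j - x j * v i) ^ 2 / (ε j * a i - ε i * a j)) := by
  rw [Ppoly, finsetSum_coeff, Finset.mul_sum]
  refine Finset.sum_congr rfl fun i hi => ?_
  have hcard : ((Finset.Icc 1 d).erase i).card = d - 1 := by
    simp [Finset.card_erase_of_mem hi]
  have h := coeff_card_prod_C_sub_C_mul_X ((Finset.Icc 1 d).erase i) a ε
  rw [hcard] at h
  rw [coeff_C_mul, h, ← Finset.mul_prod_erase _ ε hi]
  ring

theorem prod_signs_eq (k l : ℕ) (ε : ℕ → ℝ) (hpos : ∀ i ∈ Finset.Icc 1 k, ε i = 1)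
    (hneg : ∀ i ∈ Finset.Icc (k + 1) (k + l), ε i = -1) :
    ∏ j ∈ Finset.Icc 1 (k + l), ε j = (-1) ^ l := by
  have hunion : Finset.Icc 1 (k + l) = Finset.Icc 1 k ∪ Finset.Icc (k + 1) (k + l) := by
    ext i
    simp only [Finset.mem_union, Finset.mem_Icc]
    omega
  have hdisj : Disjoint (Finset.Icc 1 k) (Finset.Icc (k + 1) (k + l)) := by
    rw [Finset.disjoint_left]
    intro i
    simp only [Finset.mem_Icc]
    omega
  rw [hunion, Finset.prod_union hdisj, Finset.prod_congr rfl hpos, Finset.prod_congr rfl hneg]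
  simp

/- STATEMENT 4: Σ_i F_i(x,v) = ⟨v,v⟩; the coefficient of λ^{d−1} in P_{x,v} equals
(−1)^{d−1+l}·⟨v,v⟩; and deg P_{x,v} ≤ d−2 iff v is light-like. -/
theorem stmt4 (k l d : ℕ) (hk : 1 ≤ k) (hl : 1 ≤ l) (hd : d = k + l)
    (a ε : ℕ → ℝ)
    (hε1 : ∀ i ∈ Finset.Icc 1 k, ε i = 1)
    (hε2 : ∀ i ∈ Finset.Icc (k + 1) d, ε i = -1)
    (hapos : ∀ i ∈ Finset.Icc 1 d, 0 < a i)
    (hadec : ∀ i, 1 ≤ i → i < k → a (i + 1) < a i)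
    (hainc : ∀ i, k + 1 ≤ i → i < d → a i < a (i + 1))
    (x v : ℕ → ℝ) :
    (∑ i ∈ Finset.Icc 1 d,
        (ε i * v i ^ 2 +
          ∑ j ∈ (Finset.Icc 1 d).erase i,
            (x i * v j - x j * v i) ^ 2 / (ε j * a i - ε i * a j))
      = ∑ i ∈ Finset.Icc 1 d, ε i * v i * v i) ∧
    ((Ppoly d a ε x v).coeff (d - 1)
      = (-1 : ℝ) ^ (d - 1 + l) * ∑ i ∈ Finset.Icc 1 d, ε i * v i * v i) ∧
    ((Ppoly d a ε x v).degree ≤ (d - 2 : ℕ) ↔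
      ∑ i ∈ Finset.Icc 1 d, ε i * v i * v i = 0) := by
  have hsum : ∑ i ∈ Finset.Icc 1 d,
        (ε i * v i ^ 2 +
          ∑ j ∈ (Finset.Icc 1 d).erase i,
            (x i * v j - x j * v i) ^ 2 / (ε j * a i - ε i * a j))
      = ∑ i ∈ Finset.Icc 1 d, ε i * v i * v i := by
    rw [Finset.sum_add_distrib, sum_sum_erase_eq_zero_of_antisymm, add_zero]
    · exact Finset.sum_congr rfl fun i _ => by ring
    · intro i j
      rw [← neg_sub (ε j * a i), div_neg, ← neg_sub (x i * v j), neg_sq]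
  have hcoeff : (Ppoly d a ε x v).coeff (d - 1)
      = (-1 : ℝ) ^ (d - 1 + l) * ∑ i ∈ Finset.Icc 1 d, ε i * v i * v i := by
    have hprod : ∏ j ∈ Finset.Icc 1 d, ε j = (-1) ^ l := by
      subst hd
      exact prod_signs_eq k l ε hε1 hε2
    rw [coeff_Ppoly, hsum, hprod, pow_add]
  have hzero : (Ppoly d a ε x v).coeff (d - 1) = 0 ↔
      ∑ i ∈ Finset.Icc 1 d, ε i * v i * v i = 0 := by
    simp [hcoeff]
  refine ⟨hsum, hcoeff, ?_⟩
  rw [← hzero, degree_le_iff_coeff_zero]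
  constructor
  · intro h
    exact h _ (by exact_mod_cast (by omega : d - 2 < d - 1))
  · intro h m hm
    have hm' : d - 2 < m := by exact_mod_cast hm
    rcases (by omega : m = d - 1 ∨ d - 1 < m) with rfl | hlt
    · exact h
    · exact coeff_eq_zero_of_natDegree_lt ((natDegree_Ppoly_le d a ε x v).trans_lt hlt)
end

section
/- Let x ∈ ℝ^d satisfy Σ_{i=1}^d x_i²/a_i < 1 (x is inside the ellipsoid E) and x_i ≠ 0 for every i. Then the equation Σ_{i=1}^d x_i²/(a_i − ε_i λ) = 1 has exactly d real solutions λ: exactly one in each of the d open intervals (−a_d, −a_{d−1}), …, (−a_{k+2}, −a_{k+1}), (−a_{k+1}, 0), (0, a_k), (a_k, a_{k−1}), …, (a₂, a₁), and no solutions outside these intervals. In particular, x lies on exactly d pairwise distinct quadrics of the confocal family, and exactly two of them — those with parameters in (−a_{k+1}, 0) and in (0, a_k) — are ellipsoids. -/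
open Filter Topology

/-- An equation `∑ c i / (p i - t) = 1` has at most as many solutions as it has terms. -/
theorem finite_and_ncard_le_of_sum_div_sub_eq_one (s : Finset ℕ) (c p : ℕ → ℝ) :
    {t : ℝ | (∀ i ∈ s, p i ≠ t) ∧ ∑ i ∈ s, c i / (p i - t) = 1}.Finite ∧
    {t : ℝ | (∀ i ∈ s, p i ≠ t) ∧ ∑ i ∈ s, c i / (p i - t) = 1}.ncard ≤ s.card := by
  classical
  set P : Polynomial ℝ := Lagrange.nodal s p +
    ∑ i ∈ s, Polynomial.C (c i) * Lagrange.nodal (s.erase i) p with hP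
  have hdeg : (∑ i ∈ s, Polynomial.C (c i) * Lagrange.nodal (s.erase i) p).degree <
      (Lagrange.nodal s p).degree := by
    rw [Lagrange.degree_nodal]
    refine (Polynomial.degree_sum_le _ _).trans_lt ?_
    rw [Finset.sup_lt_iff (WithBot.bot_lt_coe _)]
    intro i hi
    rw [← Polynomial.smul_eq_C_mul]
    refine (Polynomial.degree_smul_le _ _).trans_lt ?_
    rw [Lagrange.degree_nodal]
    exact_mod_cast Finset.card_erase_lt_of_mem hi
  have hmonic : P.Monic := (Lagrange.nodal_monic).add_of_left hdeg
  have hnat : P.natDegree = s.card := by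
    apply Polynomial.natDegree_eq_of_degree_eq_some
    rw [hP, Polynomial.degree_add_eq_left_of_degree_lt hdeg, Lagrange.degree_nodal]
  have hsub : {t : ℝ | (∀ i ∈ s, p i ≠ t) ∧ ∑ i ∈ s, c i / (p i - t) = 1} ⊆
      (P.roots.toFinset : Set ℝ) := by
    rintro t ⟨ht, hsum⟩
    have hterm : ∀ i ∈ s, c i * (Lagrange.nodal (s.erase i) p).eval t =
        -(c i / (p i - t)) * (Lagrange.nodal s p).eval t := by
      intro i hi
      rw [Lagrange.nodal_eq_mul_nodal_erase hi]
      have : p i - t ≠ 0 := sub_ne_zero.2 (ht i hi)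
      simp only [Polynomial.eval_mul, Polynomial.eval_sub, Polynomial.eval_X, Polynomial.eval_C]
      field_simp
      ring
    have hroot : P.eval t = 0 := by
      rw [hP, Polynomial.eval_add, Polynomial.eval_finsetSum]
      simp only [Polynomial.eval_mul, Polynomial.eval_C]
      rw [Finset.sum_congr rfl hterm, ← Finset.sum_mul, Finset.sum_neg_distrib, hsum]
      ring
    simpa [hmonic.ne_zero] using hroot
  refine ⟨(Finset.finite_toSet _).subset hsub, ?_⟩
  calc _ ≤ (P.roots.toFinset : Set ℝ).ncard := Set.ncard_le_ncard hsub (Finset.finite_toSet _)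
    _ = P.roots.toFinset.card := Set.ncard_coe_finset _
    _ ≤ P.roots.card := Multiset.toFinset_card_le _
    _ ≤ s.card := hnat ▸ P.card_roots'

/-- Away from its poles, a sum of simple fractions is continuous. -/
theorem continuousOn_sum_div_sub {s : Finset ℕ} (c : ℕ → ℝ) {p : ℕ → ℝ} {U : Set ℝ}
    (h : ∀ t ∈ U, ∀ i ∈ s, p i ≠ t) :
    ContinuousOn (fun t => ∑ i ∈ s, c i / (p i - t)) U :=
  continuousOn_finsetSum _ fun i hi =>
    continuousOn_const.div (by fun_prop) fun t ht => sub_ne_zero.2 (h t ht i hi)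

theorem tendsto_sum_div_sub_erase {s : Finset ℕ} (c : ℕ → ℝ) {p : ℕ → ℝ}
    (hp : Set.InjOn p s) {i : ℕ} (hi : i ∈ s) {F : Filter ℝ} (hF : F ≤ 𝓝 (p i)) :
    Tendsto (fun t => ∑ j ∈ s.erase i, c j / (p j - t)) F
      (𝓝 (∑ j ∈ s.erase i, c j / (p j - p i))) := by
  refine tendsto_finsetSum _ fun j hj => ?_
  obtain ⟨hne, hj⟩ := Finset.mem_erase.1 hj
  have hid : Tendsto (fun t : ℝ => t) F (𝓝 (p i)) := hF
  exact tendsto_const_nhds.div (tendsto_const_nhds.sub hid)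
    (sub_ne_zero.2 fun h => hne (hp hj hi h))

theorem tendsto_sum_div_sub_atTop {s : Finset ℕ} {c p : ℕ → ℝ}
    (hp : Set.InjOn p s) {i : ℕ} (hi : i ∈ s) {F : Filter ℝ} (hF : F ≤ 𝓝 (p i))
    (h : Tendsto (fun t => c i / (p i - t)) F atTop) :
    Tendsto (fun t => ∑ j ∈ s, c j / (p j - t)) F atTop :=
  (h.atTop_add (tendsto_sum_div_sub_erase c hp hi hF)).congr fun _ =>
    Finset.add_sum_erase s (fun j => c j / (p j - _)) hi

theorem tendsto_sum_div_sub_atBot {s : Finset ℕ} {c p : ℕ → ℝ}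
    (hp : Set.InjOn p s) {i : ℕ} (hi : i ∈ s) {F : Filter ℝ} (hF : F ≤ 𝓝 (p i))
    (h : Tendsto (fun t => c i / (p i - t)) F atBot) :
    Tendsto (fun t => ∑ j ∈ s, c j / (p j - t)) F atBot :=
  (h.atBot_add (tendsto_sum_div_sub_erase c hp hi hF)).congr fun _ =>
    Finset.add_sum_erase s (fun j => c j / (p j - _)) hi

theorem tendsto_inv_sub_nhdsLT (p : ℝ) : Tendsto (fun t => (p - t)⁻¹) (𝓝[<] p) atTop := by
  refine tendsto_inv_nhdsGT_zero.comp (tendsto_nhdsWithin_iff.2 ⟨?_, ?_⟩)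
  · have : Tendsto (fun t => p - t) (𝓝 p) (𝓝 (p - p)) :=
      tendsto_const_nhds.sub tendsto_id
    rw [sub_self] at this
    exact this.mono_left nhdsWithin_le_nhds
  · filter_upwards [self_mem_nhdsWithin] with t ht using sub_pos.2 (Set.mem_Iio.1 ht)

theorem tendsto_inv_sub_nhdsGT (p : ℝ) : Tendsto (fun t => (p - t)⁻¹) (𝓝[>] p) atBot := by
  refine tendsto_inv_nhdsLT_zero.comp (tendsto_nhdsWithin_iff.2 ⟨?_, ?_⟩)
  · have : Tendsto (fun t => p - t) (𝓝 p) (𝓝 (p - p)) :=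
      tendsto_const_nhds.sub tendsto_id
    rw [sub_self] at this
    exact this.mono_left nhdsWithin_le_nhds
  · filter_upwards [self_mem_nhdsWithin] with t ht using sub_neg.2 (Set.mem_Ioi.1 ht)

/-- If a set of at most `d` reals meets each of `d` consecutive open intervals, then it is covered
by them and meets each of them exactly once. -/
theorem exists_mem_Ioo_and_existsUnique_of_ncard_le {d : ℕ} {b : ℕ → ℝ} {S : Set ℝ}
    (hb : ∀ m n, 1 ≤ m → m ≤ n → n ≤ d + 1 → b n ≤ b m) (hS : S.Finite) (hcard : S.ncard ≤ d)
    (hex : ∀ n, 1 ≤ n → n ≤ d → ∃ t ∈ S, t ∈ Set.Ioo (b (n + 1)) (b n)) :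
    (∀ t ∈ S, ∃ n, 1 ≤ n ∧ n ≤ d ∧ t ∈ Set.Ioo (b (n + 1)) (b n)) ∧
    ∀ n, 1 ≤ n → n ≤ d → ∃! t, t ∈ Set.Ioo (b (n + 1)) (b n) ∧ t ∈ S := by
  classical
  choose! g hgS hgI using hex
  have hdisj : ∀ m n t, 1 ≤ m → m ≤ d → 1 ≤ n → n ≤ d → t ∈ Set.Ioo (b (m + 1)) (b m) →
      t ∈ Set.Ioo (b (n + 1)) (b n) → m = n := by
    intro m n t hm hm' hn hn' h1 h2
    rcases lt_trichotomy m n with h | h | h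
    · have := hb (m + 1) n (by omega) (by omega) (by omega)
      linarith [h1.1, h2.2]
    · exact h
    · have := hb (n + 1) m (by omega) (by omega) (by omega)
      linarith [h2.1, h1.2]
  have himage : (((Finset.Icc 1 d).image g : Finset ℝ) : Set ℝ) = S := by
    refine Set.eq_of_subset_of_ncard_le ?_ ?_ hS
    · intro t ht
      obtain ⟨n, hn, rfl⟩ := Finset.mem_image.1 (Finset.mem_coe.1 ht)
      rw [Finset.mem_Icc] at hn
      exact hgS n hn.1 hn.2
    · rw [Set.ncard_coe_finset, Finset.card_image_of_injOn, Nat.card_Icc]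
      · simpa using hcard
      · intro m hm n hn hmn
        simp only [Finset.coe_Icc, Set.mem_Icc] at hm hn
        exact hdisj m n (g m) hm.1 hm.2 hn.1 hn.2 (hgI m hm.1 hm.2) (hmn ▸ hgI n hn.1 hn.2)
  have hmem : ∀ t ∈ S, ∃ n, 1 ≤ n ∧ n ≤ d ∧ g n = t := by
    intro t ht
    rw [← himage] at ht
    obtain ⟨n, hn, rfl⟩ := Finset.mem_image.1 (Finset.mem_coe.1 ht)
    rw [Finset.mem_Icc] at hn
    exact ⟨n, hn.1, hn.2, rfl⟩
  constructor
  · intro t ht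
    obtain ⟨n, h1, h2, rfl⟩ := hmem t ht
    exact ⟨n, h1, h2, hgI n h1 h2⟩
  · intro n h1 h2
    refine ⟨g n, ⟨hgI n h1 h2, hgS n h1 h2⟩, ?_⟩
    rintro t ⟨htI, htS⟩
    obtain ⟨m, h3, h4, rfl⟩ := hmem t htS
    rw [hdisj m n (g m) h3 h4 h1 h2 (hgI m h3 h4) htI]


/- STATEMENT 5: for x inside the ellipsoid with all coordinates nonzero, the equation
Σ x_i²/(a_i − ε_i λ) = 1 has exactly d real solutions: exactly one in each of the
intervals (−a_d,−a_{d−1}), …, (−a_{k+2},−a_{k+1}), (−a_{k+1},0), (0,a_k),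
(a_k,a_{k−1}), …, (a₂,a₁) and none elsewhere; in particular x lies on exactly d
pairwise distinct confocal quadrics, exactly two of which (parameters in
(−a_{k+1},0) and (0,a_k)) are ellipsoids. -/
theorem stmt5 (k l d : ℕ) (hk : 1 ≤ k) (hl : 1 ≤ l) (hd : d = k + l)
    (a ε : ℕ → ℝ)
    (hε1 : ∀ i ∈ Finset.Icc 1 k, ε i = 1)
    (hε2 : ∀ i ∈ Finset.Icc (k + 1) d, ε i = -1)
    (hapos : ∀ i ∈ Finset.Icc 1 d, 0 < a i)
    (hadec : ∀ i, 1 ≤ i → i < k → a (i + 1) < a i)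
    (hainc : ∀ i, k + 1 ≤ i → i < d → a i < a (i + 1))
    (x : ℕ → ℝ)
    (hx : ∑ i ∈ Finset.Icc 1 d, x i ^ 2 / a i < 1)
    (hxi : ∀ i ∈ Finset.Icc 1 d, x i ≠ 0) :
    (∀ lam : ℝ,
      ((∀ i ∈ Finset.Icc 1 d, a i - ε i * lam ≠ 0) ∧
        ∑ i ∈ Finset.Icc 1 d, x i ^ 2 / (a i - ε i * lam) = 1) →
      (lam ∈ Set.Ioo (-a (k + 1)) 0 ∨ lam ∈ Set.Ioo 0 (a k) ∨
        (∃ i ∈ Finset.Icc 1 (k - 1), lam ∈ Set.Ioo (a (i + 1)) (a i)) ∨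
        (∃ j ∈ Finset.Icc (k + 1) (d - 1), lam ∈ Set.Ioo (-a (j + 1)) (-a j)))) ∧
    (∃! lam : ℝ, lam ∈ Set.Ioo (-a (k + 1)) 0 ∧
      (∀ i ∈ Finset.Icc 1 d, a i - ε i * lam ≠ 0) ∧
      ∑ i ∈ Finset.Icc 1 d, x i ^ 2 / (a i - ε i * lam) = 1) ∧
    (∃! lam : ℝ, lam ∈ Set.Ioo 0 (a k) ∧
      (∀ i ∈ Finset.Icc 1 d, a i - ε i * lam ≠ 0) ∧
      ∑ i ∈ Finset.Icc 1 d, x i ^ 2 / (a i - ε i * lam) = 1) ∧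
    (∀ i ∈ Finset.Icc 1 (k - 1),
      ∃! lam : ℝ, lam ∈ Set.Ioo (a (i + 1)) (a i) ∧
        (∀ i' ∈ Finset.Icc 1 d, a i' - ε i' * lam ≠ 0) ∧
        ∑ i' ∈ Finset.Icc 1 d, x i' ^ 2 / (a i' - ε i' * lam) = 1) ∧
    (∀ j ∈ Finset.Icc (k + 1) (d - 1),
      ∃! lam : ℝ, lam ∈ Set.Ioo (-a (j + 1)) (-a j) ∧
        (∀ i' ∈ Finset.Icc 1 d, a i' - ε i' * lam ≠ 0) ∧
        ∑ i' ∈ Finset.Icc 1 d, x i' ^ 2 / (a i' - ε i' * lam) = 1) ∧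
    (∃ lam1 lam2 : ℝ, lam1 ≠ lam2 ∧
      lam1 ∈ Set.Ioo (-a (k + 1)) (a k) ∧ lam2 ∈ Set.Ioo (-a (k + 1)) (a k) ∧
      (∀ i ∈ Finset.Icc 1 d, a i - ε i * lam1 ≠ 0) ∧
      (∀ i ∈ Finset.Icc 1 d, a i - ε i * lam2 ≠ 0) ∧
      ∑ i ∈ Finset.Icc 1 d, x i ^ 2 / (a i - ε i * lam1) = 1 ∧
      ∑ i ∈ Finset.Icc 1 d, x i ^ 2 / (a i - ε i * lam2) = 1 ∧
      ∀ mu : ℝ, mu ∈ Set.Ioo (-a (k + 1)) (a k) →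
        (∀ i ∈ Finset.Icc 1 d, a i - ε i * mu ≠ 0) →
        ∑ i ∈ Finset.Icc 1 d, x i ^ 2 / (a i - ε i * mu) = 1 →
        mu = lam1 ∨ mu = lam2) := by
  obtain ⟨b, hbk, hb0, hbl⟩ : ∃ b : ℕ → ℝ, (∀ n, n ≤ k → b n = a n) ∧ b (k + 1) = 0 ∧
      ∀ n, k + 1 ≤ n → b (n + 1) = -a n := by
    refine ⟨fun n => if n ≤ k then a n else if n = k + 1 then 0 else -a (n - 1), ?_, ?_, ?_⟩
    · intro n hn
      simp [hn]
    · simp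
    · intro n hn
      have h1 : ¬ n + 1 ≤ k := by omega
      have h2 : n ≠ k := by omega
      simp [h1, h2]
  have hbstep : ∀ n, 1 ≤ n → n ≤ d → b (n + 1) < b n := by
    intro n h1 h2
    rcases lt_trichotomy n k with h | rfl | h
    · rw [hbk _ h, hbk _ h.le]
      exact hadec n h1 h
    · rw [hb0, hbk _ le_rfl]
      exact hapos n (Finset.mem_Icc.2 ⟨h1, h2⟩)
    · rw [hbl n h]
      obtain rfl | h' := eq_or_lt_of_le (Nat.succ_le_of_lt h)
      · rw [Nat.succ_eq_add_one, hb0]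
        exact neg_lt_zero.2 (hapos _ (Finset.mem_Icc.2 ⟨h1, h2⟩))
      · obtain ⟨m, rfl⟩ : ∃ m, n = m + 1 := ⟨n - 1, by omega⟩
        rw [hbl m (by omega)]
        exact neg_lt_neg (hainc m (by omega) (by omega))
  have hblt : ∀ m n, 1 ≤ m → m < n → n ≤ d + 1 → b n < b m := by
    intro m n hm hmn
    induction n, hmn using Nat.le_induction with
    | base => exact fun h => hbstep m hm (by omega)
    | succ n hn ih =>
      intro h
      exact (hbstep n (by omega) (by omega)).trans (ih (by omega))
  have hble : ∀ m n, 1 ≤ m → m ≤ n → n ≤ d + 1 → b n ≤ b m := by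
    intro m n hm hmn hn
    obtain rfl | h := hmn.eq_or_lt
    · exact le_rfl
    · exact (hblt m n hm h hn).le
  set p : ℕ → ℝ := fun i => ε i * a i with hp
  set c : ℕ → ℝ := fun i => ε i * x i ^ 2 with hc
  have hε : ∀ i ∈ Finset.Icc 1 d, ε i = 1 ∨ ε i = -1 := by
    intro i hi
    rw [Finset.mem_Icc] at hi
    by_cases h : i ≤ k
    · exact .inl (hε1 i (Finset.mem_Icc.2 ⟨hi.1, h⟩))
    · exact .inr (hε2 i (Finset.mem_Icc.2 ⟨by omega, hi.2⟩))
  have hpk : ∀ i, 1 ≤ i → i ≤ k → p i = b i := by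
    intro i h1 h2
    simp [hp, hε1 i (Finset.mem_Icc.2 ⟨h1, h2⟩), hbk i h2]
  have hpl : ∀ i, k + 1 ≤ i → i ≤ d → p i = b (i + 1) := by
    intro i h1 h2
    simp [hp, hε2 i (Finset.mem_Icc.2 ⟨h1, h2⟩), hbl i h1]
  have hpb : ∀ i ∈ Finset.Icc 1 d, ∃ m, 1 ≤ m ∧ m ≤ d + 1 ∧ p i = b m := by
    intro i hi
    rw [Finset.mem_Icc] at hi
    by_cases h : i ≤ k
    · exact ⟨i, hi.1, by omega, hpk i hi.1 h⟩
    · exact ⟨i + 1, by omega, by omega, hpl i (by omega) hi.2⟩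
  have hpanti : ∀ i j, 1 ≤ i → i < j → j ≤ d → p j < p i := by
    intro i j hi hij hj
    by_cases h1 : i ≤ k <;> by_cases h2 : j ≤ k
    · rw [hpk i hi h1, hpk j (by omega) h2]
      exact hblt _ _ hi hij (by omega)
    · rw [hpk i hi h1, hpl j (by omega) hj]
      exact hblt _ _ hi (by omega) (by omega)
    · omega
    · rw [hpl i (by omega) (by omega), hpl j (by omega) hj]
      exact hblt _ _ (by omega) (by omega) (by omega)
  have hpinj : Set.InjOn p (Finset.Icc 1 d) := by
    intro i hi j hj hij
    simp only [Finset.coe_Icc, Set.mem_Icc] at hi hj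
    rcases lt_trichotomy i j with h | h | h
    · exact absurd hij (hpanti i j hi.1 h hj.2).ne'
    · exact h
    · exact absurd hij (hpanti j i hj.1 h hi.2).ne
  have hpI : ∀ n, 1 ≤ n → n ≤ d → ∀ t ∈ Set.Ioo (b (n + 1)) (b n), ∀ i ∈ Finset.Icc 1 d,
      p i ≠ t := by
    rintro n h1 h2 t ht i hi rfl
    obtain ⟨m, hm1, hm2, hm⟩ := hpb i hi
    rw [hm] at ht
    rcases le_or_gt m n with h | h
    · exact absurd ht.2 (hble m n hm1 h (by omega)).not_gt
    · exact absurd ht.1 (hble (n + 1) m (by omega) h hm2).not_gt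
  have hp0 : ∀ i ∈ Finset.Icc 1 d, p i ≠ 0 := by
    intro i hi
    have := (hapos i hi).ne'
    rcases hε i hi with h | h <;> simp [hp, h, this]
  have hpole : ∀ i ∈ Finset.Icc 1 d, ∀ t : ℝ, a i - ε i * t = ε i * (p i - t) := by
    intro i hi t
    rcases hε i hi with h | h <;> simp only [hp, h] <;> ring
  have hiff : ∀ t : ℝ, ((∀ i ∈ Finset.Icc 1 d, a i - ε i * t ≠ 0) ∧
      ∑ i ∈ Finset.Icc 1 d, x i ^ 2 / (a i - ε i * t) = 1) ↔
      t ∈ {t : ℝ | (∀ i ∈ Finset.Icc 1 d, p i ≠ t) ∧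
        ∑ i ∈ Finset.Icc 1 d, c i / (p i - t) = 1} := by
    intro t
    refine and_congr (forall₂_congr fun i hi => ?_) ?_
    · rw [hpole i hi, ← sub_ne_zero (a := p i), mul_ne_zero_iff]
      rcases hε i hi with h | h <;> simp only [h] <;> norm_num
    · rw [Finset.sum_congr rfl fun i hi => ?_]
      rw [hpole i hi]
      rcases hε i hi with h | h
      · simp [hc, h]
      · simp only [hc, h, neg_one_mul, div_neg, neg_div]
  have hsum0 : ∑ i ∈ Finset.Icc 1 d, c i / (p i - 0) < 1 := by
    refine lt_of_eq_of_lt (Finset.sum_congr rfl fun i hi => ?_) hx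
    rcases hε i hi with h | h <;> simp [hc, hp, h]
  have hcpos : ∀ i, 1 ≤ i → i ≤ k → 0 < c i := by
    intro i h1 h2
    have := hxi i (Finset.mem_Icc.2 ⟨h1, by omega⟩)
    simp only [hc, hε1 i (Finset.mem_Icc.2 ⟨h1, h2⟩)]
    positivity
  have hcneg : ∀ i, k + 1 ≤ i → i ≤ d → c i < 0 := by
    intro i h1 h2
    have := hxi i (Finset.mem_Icc.2 ⟨by omega, h2⟩)
    simp only [hc, hε2 i (Finset.mem_Icc.2 ⟨h1, h2⟩), neg_one_mul, neg_lt_zero]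
    positivity
  have hltk : ∀ i, 1 ≤ i → i ≤ k → Tendsto (fun t => ∑ j ∈ Finset.Icc 1 d, c j / (p j - t))
      (𝓝[<] p i) atTop := fun i h1 h2 =>
    tendsto_sum_div_sub_atTop hpinj (Finset.mem_Icc.2 ⟨h1, by omega⟩) nhdsWithin_le_nhds
      ((tendsto_inv_sub_nhdsLT (p i)).const_mul_atTop (hcpos i h1 h2))
  have hgtk : ∀ i, 1 ≤ i → i ≤ k → Tendsto (fun t => ∑ j ∈ Finset.Icc 1 d, c j / (p j - t))
      (𝓝[>] p i) atBot := fun i h1 h2 =>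
    tendsto_sum_div_sub_atBot hpinj (Finset.mem_Icc.2 ⟨h1, by omega⟩) nhdsWithin_le_nhds
      ((tendsto_inv_sub_nhdsGT (p i)).const_mul_atBot (hcpos i h1 h2))
  have hltl : ∀ i, k + 1 ≤ i → i ≤ d → Tendsto (fun t => ∑ j ∈ Finset.Icc 1 d, c j / (p j - t))
      (𝓝[<] p i) atBot := fun i h1 h2 =>
    tendsto_sum_div_sub_atBot hpinj (Finset.mem_Icc.2 ⟨by omega, h2⟩) nhdsWithin_le_nhds
      ((tendsto_inv_sub_nhdsLT (p i)).const_mul_atTop_of_neg (hcneg i h1 h2))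
  have hgtl : ∀ i, k + 1 ≤ i → i ≤ d → Tendsto (fun t => ∑ j ∈ Finset.Icc 1 d, c j / (p j - t))
      (𝓝[>] p i) atTop := fun i h1 h2 =>
    tendsto_sum_div_sub_atTop hpinj (Finset.mem_Icc.2 ⟨by omega, h2⟩) nhdsWithin_le_nhds
      ((tendsto_inv_sub_nhdsGT (p i)).const_mul_atBot_of_neg (hcneg i h1 h2))
  have hex : ∀ n, 1 ≤ n → n ≤ d → ∃ t ∈ {t : ℝ | (∀ i ∈ Finset.Icc 1 d, p i ≠ t) ∧
      ∑ i ∈ Finset.Icc 1 d, c i / (p i - t) = 1}, t ∈ Set.Ioo (b (n + 1)) (b n) := by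
    intro n h1 h2
    suffices h : ∃ t ∈ Set.Ioo (b (n + 1)) (b n), ∑ i ∈ Finset.Icc 1 d, c i / (p i - t) = 1 by
      obtain ⟨t, ht, h⟩ := h
      exact ⟨t, ⟨hpI n h1 h2 t ht, h⟩, ht⟩
    have hstep := hbstep n h1 h2
    have hleft : 𝓝[>] b (n + 1) ≤ 𝓟 (Set.Ioo (b (n + 1)) (b n)) :=
      le_principal_iff.2 (Ioo_mem_nhdsGT hstep)
    have hright : 𝓝[<] b n ≤ 𝓟 (Set.Ioo (b (n + 1)) (b n)) :=
      le_principal_iff.2 (Ioo_mem_nhdsLT hstep)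
    have hcont := continuousOn_sum_div_sub c (hpI n h1 h2)
    rcases lt_trichotomy n k with h | rfl | h
    · have hl' := hgtk (n + 1) (by omega) h
      have hr' := hltk n h1 h.le
      rw [hpk (n + 1) (by omega) h] at hl'
      rw [hpk n h1 h.le] at hr'
      exact isPreconnected_Ioo.intermediate_value_Iii hleft hright hcont hl' hr'
        (Set.mem_univ 1)
    · rw [hb0] at hstep hcont hright ⊢
      have hr' := hltk n h1 le_rfl
      rw [hpk n h1 le_rfl] at hr'
      have hcont' : ContinuousOn (fun t => ∑ i ∈ Finset.Icc 1 d, c i / (p i - t))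
          (Set.Ico 0 (b n)) := by
        refine continuousOn_sum_div_sub c fun t ht i hi => ?_
        obtain h0 | h0 := ht.1.eq_or_lt
        · exact h0 ▸ hp0 i hi
        · exact hpI n h1 h2 t ⟨hb0.symm ▸ h0, ht.2⟩ i hi
      obtain ⟨t, ht, h⟩ := isPreconnected_Ico.intermediate_value_Ici
        (Set.left_mem_Ico.2 hstep) (hright.trans (principal_mono.2 Set.Ioo_subset_Ico_self))
        hcont' hr' hsum0.le
      refine ⟨t, ⟨ht.1.lt_of_ne ?_, ht.2⟩, h⟩
      rintro rfl
      exact hsum0.ne h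
    · have hl' := hgtl n h h2
      rw [hpl n h h2] at hl'
      obtain rfl | h' := eq_or_lt_of_le (Nat.succ_le_of_lt h)
      · simp only [Nat.succ_eq_add_one] at *
        rw [hb0] at hstep hcont hleft ⊢
        have hcont' : ContinuousOn (fun t => ∑ i ∈ Finset.Icc 1 d, c i / (p i - t))
            (Set.Ioc (b (k + 1 + 1)) 0) := by
          refine continuousOn_sum_div_sub c fun t ht i hi => ?_
          obtain h0 | h0 := ht.2.eq_or_lt
          · exact h0 ▸ hp0 i hi
          · exact hpI (k + 1) h1 h2 t ⟨ht.1, hb0.symm ▸ h0⟩ i hi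
        obtain ⟨t, ht, h⟩ := isPreconnected_Ioc.intermediate_value_Ici
          (Set.right_mem_Ioc.2 hstep) (hleft.trans (principal_mono.2 Set.Ioo_subset_Ioc_self))
          hcont' hl' hsum0.le
        refine ⟨t, ⟨ht.1, ht.2.lt_of_ne ?_⟩, h⟩
        rintro rfl
        exact hsum0.ne h
      · obtain ⟨m, rfl⟩ : ∃ m, n = m + 1 := ⟨n - 1, by omega⟩
        have hr' := hltl m (by omega) (by omega)
        rw [hpl m (by omega) (by omega)] at hr'
        exact isPreconnected_Ioo.intermediate_value_Iii hright hleft hcont hr' hl'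
          (Set.mem_univ 1)
  obtain ⟨hfin, hcard⟩ := finite_and_ncard_le_of_sum_div_sub_eq_one (Finset.Icc 1 d) c p
  rw [Nat.card_Icc, Nat.add_sub_cancel] at hcard
  obtain ⟨hcover, huniq⟩ := exists_mem_Ioo_and_existsUnique_of_ncard_le hble hfin hcard hex
  simp only [← hiff] at hcover huniq
  have hneg := huniq (k + 1) (by omega) (by omega)
  rw [hbl (k + 1) le_rfl, hb0] at hneg
  have hpos := huniq k hk (by omega)
  rw [hb0, hbk k le_rfl] at hpos
  refine ⟨?_, hneg, hpos, ?_, ?_, ?_⟩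
  · intro t ht
    obtain ⟨n, h1, h2, hn⟩ := hcover t ht
    rcases lt_trichotomy n k with h | rfl | h
    · rw [hbk n h.le, hbk (n + 1) h] at hn
      exact .inr (.inr (.inl ⟨n, Finset.mem_Icc.2 ⟨h1, by omega⟩, hn⟩))
    · rw [hb0, hbk n le_rfl] at hn
      exact .inr (.inl hn)
    · rw [hbl n h] at hn
      obtain rfl | h' := eq_or_lt_of_le (Nat.succ_le_of_lt h)
      · rw [Nat.succ_eq_add_one, hb0] at hn
        exact .inl hn
      · obtain ⟨m, rfl⟩ : ∃ m, n = m + 1 := ⟨n - 1, by omega⟩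
        rw [hbl m (by omega)] at hn
        exact .inr (.inr (.inr ⟨m, Finset.mem_Icc.2 ⟨by omega, by omega⟩, hn⟩))
  · intro i hi
    rw [Finset.mem_Icc] at hi
    have := huniq i hi.1 (by omega)
    rwa [hbk i (by omega), hbk (i + 1) (by omega)] at this
  · intro j hj
    rw [Finset.mem_Icc] at hj
    have := huniq (j + 1) (by omega) (by omega)
    rwa [hbl j hj.1, hbl (j + 1) (by omega)] at this
  · obtain ⟨t₁, ⟨hI₁, hne₁, hsum₁⟩, hu₁⟩ := hneg
    obtain ⟨t₂, ⟨hI₂, hne₂, hsum₂⟩, hu₂⟩ := hpos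
    refine ⟨t₁, t₂, (hI₁.2.trans hI₂.1).ne, ⟨hI₁.1, hI₁.2.trans (hI₂.1.trans hI₂.2)⟩,
      ⟨hI₁.1.trans (hI₁.2.trans hI₂.1), hI₂.2⟩, hne₁, hne₂, hsum₁, hsum₂, ?_⟩
    intro mu hmu hne hsum
    rcases lt_trichotomy mu 0 with h | rfl | h
    · exact .inl (hu₁ mu ⟨⟨hmu.1, h⟩, hne, hsum⟩)
    · simp only [mul_zero, sub_zero] at hsum
      exact absurd hsum hx.ne
    · exact .inr (hu₂ mu ⟨⟨h, hmu.2⟩, hne, hsum⟩)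
end

section
/- For every t ∈ ℝ with cos 2t ∉ {1, −1}, set μ(t) = (a + b − (a−b)cos 2t)/2. Then μ(t) ∈ (b, a); the whole light-like line {r₊(λ, t) : λ ∈ ℝ} is contained in the one-sheeted hyperboloid Q_{μ(t)}, i.e. every point r₊(λ,t) satisfies x²/(a−μ(t)) + y²/(b−μ(t)) + z²/(c+μ(t)) = 1; and the point r₊(μ(t), t) lies on a tropic curve of Q_{μ(t)}, i.e. it satisfies x²/(a−μ(t))² + y²/(b−μ(t))² − z²/(c+μ(t))² = 0. The same statements hold for r₋. -/
/- STATEMENT 6: For t with cos 2t ∉ {1,−1}, μ(t) = (a+b−(a−b)cos 2t)/2 lies in (b,a),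
the whole light-like generatrix {r₊(λ,t) : λ ∈ ℝ} is contained in the one-sheeted
hyperboloid Q_{μ(t)}, and r₊(μ(t),t) lies on a tropic curve of Q_{μ(t)}.
The same holds for r₋ (handled by the sign parameter `sgn`). -/
theorem stmt6 (a b c : ℝ) (hab : b < a) (hb : 0 < b) (hc : 0 < c)
    (g : ℝ → ℝ)
    (hg : ∀ t, g t = Real.sqrt (Real.cos t ^ 2 / (a + c) + Real.sin t ^ 2 / (b + c)))
    (sgn : ℝ) (hsgn : sgn = 1 ∨ sgn = -1)
    (r : ℝ → ℝ → ℝ × ℝ × ℝ)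
    (hr : ∀ lam t, r lam t =
      ((a - lam) * Real.cos t / Real.sqrt (a + c),
       (b - lam) * Real.sin t / Real.sqrt (b + c),
       sgn * ((c + lam) * g t)))
    (t : ℝ) (ht1 : Real.cos (2 * t) ≠ 1) (ht2 : Real.cos (2 * t) ≠ -1)
    (μ : ℝ) (hμ : μ = (a + b - (a - b) * Real.cos (2 * t)) / 2) :
    μ ∈ Set.Ioo b a ∧
    (∀ lam : ℝ,
      (r lam t).1 ^ 2 / (a - μ) + (r lam t).2.1 ^ 2 / (b - μ) +
        (r lam t).2.2 ^ 2 / (c + μ) = 1) ∧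
    ((r μ t).1 ^ 2 / (a - μ) ^ 2 + (r μ t).2.1 ^ 2 / (b - μ) ^ 2 -
        (r μ t).2.2 ^ 2 / (c + μ) ^ 2 = 0) := by
  have hs2 : sgn ^ 2 = 1 := by rcases hsgn with rfl | rfl <;> norm_num
  have hcos2 : Real.cos t ^ 2 = 1 - Real.sin t ^ 2 := Real.cos_sq' t
  have hdouble : Real.cos (2 * t) = 1 - 2 * Real.sin t ^ 2 := by
    rw [Real.cos_two_mul, hcos2]; ring
  have hsin : Real.sin t ≠ 0 := fun h => ht1 (by rw [hdouble, h]; ring)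
  have hcos : Real.cos t ≠ 0 := fun h => ht2 (by rw [Real.cos_two_mul, h]; ring)
  have hS : 0 < Real.sin t ^ 2 := by positivity
  have hC : 0 < Real.cos t ^ 2 := by positivity
  have hac : 0 < a + c := by linarith
  have hbc : 0 < b + c := by linarith
  have hd : 0 < a - b := by linarith
  have ha : a - μ = (a - b) * Real.cos t ^ 2 := by rw [hμ, hdouble, hcos2]; ring
  have hb' : b - μ = -((a - b) * Real.sin t ^ 2) := by rw [hμ, hdouble]; ring
  have hx : ∀ lam, (r lam t).1 ^ 2 = (a - lam) ^ 2 * Real.cos t ^ 2 / (a + c) := fun lam => by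
    rw [hr, div_pow, mul_pow, Real.sq_sqrt hac.le]
  have hy : ∀ lam, (r lam t).2.1 ^ 2 = (b - lam) ^ 2 * Real.sin t ^ 2 / (b + c) := fun lam => by
    rw [hr, div_pow, mul_pow, Real.sq_sqrt hbc.le]
  have hg2 : g t ^ 2 = (c + μ) / ((a + c) * (b + c)) := by
    rw [hg, Real.sq_sqrt (by positivity), hμ, hdouble, hcos2]
    field_simp
    ring
  have hz : ∀ lam, (r lam t).2.2 ^ 2 = (c + lam) ^ 2 * ((c + μ) / ((a + c) * (b + c))) :=
    fun lam => by rw [hr, mul_pow, hs2, mul_pow, hg2, one_mul]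
  have hbμ : b < μ := by
    have := mul_pos hd hS
    linarith
  have hμa : μ < a := by
    have := mul_pos hd hC
    linarith
  have hcμ : 0 < c + μ := by linarith
  refine ⟨⟨hbμ, hμa⟩, fun lam => ?_, ?_⟩
  · have h1 : (r lam t).1 ^ 2 / (a - μ) = (a - lam) ^ 2 / ((a + c) * (a - b)) := by
      rw [hx, ha]; field_simp
    have h2 : (r lam t).2.1 ^ 2 / (b - μ) = -((b - lam) ^ 2 / ((b + c) * (a - b))) := by
      rw [hy, hb', div_neg]; field_simp
    have h3 : (r lam t).2.2 ^ 2 / (c + μ) = (c + lam) ^ 2 / ((a + c) * (b + c)) := by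
      rw [hz]; field_simp
    rw [h1, h2, h3]
    field_simp
    ring
  · have h1 : (r μ t).1 ^ 2 / (a - μ) ^ 2 = Real.cos t ^ 2 / (a + c) := by
      have : a - μ ≠ 0 := (sub_pos.2 hμa).ne'
      rw [hx]; field_simp
    have h2 : (r μ t).2.1 ^ 2 / (b - μ) ^ 2 = Real.sin t ^ 2 / (b + c) := by
      have : b - μ ≠ 0 := (sub_neg.2 hbμ).ne
      rw [hy]; field_simp
    have h3 : (r μ t).2.2 ^ 2 / (c + μ) ^ 2 = (c + μ) / ((a + c) * (b + c)) := by
      rw [hz]; field_simp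
    rw [h1, h2, h3, hμ, hdouble, hcos2]
    field_simp
    ring
end

section
/- Let p = (p₁, p₂) ∈ E with p₁²/a² ≠ p₂²/b² (so the tangent line of E at p is not light-like). Set n = (p₁/a, −p₂/b) (a Minkowski normal to E at p; one has ⟨n,n⟩ ≠ 0), v = p − F₁ where F₁ = (√(a+b), 0), and let v' = v − 2(⟨v,n⟩/⟨n,n⟩)·n be the Minkowski billiard reflection of v at p. Then the other focus F₂ = (−√(a+b), 0) lies on the reflected line: there exists t ∈ ℝ with F₂ = p + t v'. The analogous statement holds for the focus pair G₁ = (0, √(a+b)), G₂ = (0, −√(a+b)). -/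
/-- Coordinates of the reflection of the ray from a focus `(c, 0)` at a point `(x, y)` of the conic
`x ^ 2 / a + y ^ 2 / b = 1`, for the scalar product `u₁ w₁ - u₂ w₂`. -/
theorem exists_other_focus_eq_add_mul_reflection {a b c x y : ℝ} (ha : a ≠ 0) (hb : b ≠ 0)
    (hc : c ^ 2 = a + b) (hp : x ^ 2 / a + y ^ 2 / b = 1) (hn : (x / a) ^ 2 - (y / b) ^ 2 ≠ 0) :
    ∃ t : ℝ,
      -c = x + t * ((x - c) -
        2 * (((x - c) * (x / a) + y * (y / b)) / ((x / a) ^ 2 - (y / b) ^ 2)) * (x / a)) ∧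
      0 = y + t * (y +
        2 * (((x - c) * (x / a) + y * (y / b)) / ((x / a) ^ 2 - (y / b) ^ 2)) * (y / b)) := by
  have hvn : (x - c) * (x / a) + y * (y / b) = 1 - c * x / a := by
    rw [← hp]; ring
  have hb' : b = c ^ 2 - a := by linarith
  have hy : y ^ 2 = b * (1 - x ^ 2 / a) := by
    rw [← hp]; field_simp; ring
  have hnn : (x / a) ^ 2 - (y / b) ^ 2 = -((1 - c * x / a) * (1 + c * x / a)) / b := by
    rw [div_pow y, hy]
    field_simp
    rw [hb']
    ring
  rw [hnn] at hn
  have hA : 1 - c * x / a ≠ 0 := fun h => hn (by simp [h])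
  have hB : 1 + c * x / a ≠ 0 := fun h => hn (by simp [h])
  have hq : (1 - c * x / a) / (-((1 - c * x / a) * (1 + c * x / a)) / b)
      = -b / (1 + c * x / a) := by
    rw [div_div_eq_mul_div, ← mul_neg, mul_div_mul_left _ _ hA, div_neg, neg_div]
  refine ⟨(1 + c * x / a) / (1 - c * x / a), ?_, ?_⟩ <;> rw [hvn, hnn, hq]
  · have hAB : (1 + c * x / a) * (x - c) + 2 * b * (x / a) = -((x + c) * (1 - c * x / a)) := by
      rw [hb']; field_simp; ring
    calc -c = x + -((x + c) * (1 - c * x / a)) / (1 - c * x / a) := by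
          rw [neg_div, mul_div_cancel_right₀ _ hA]; ring
      _ = _ := by
          rw [← hAB]
          generalize 1 + c * x / a = B at *
          generalize 1 - c * x / a = A at *
          field_simp
          ring
  · have hAB : (1 + c * x / a) = 2 - (1 - c * x / a) := by ring
    rw [hAB] at hB ⊢
    generalize 1 - c * x / a = A at *
    field_simp
    ring

/- STATEMENT 8: focal reflection property of the Minkowski billiard in the ellipse E.
If the tangent at p ∈ E is not light-like, the Minkowski billiard reflection at p of the
line through F₁ passes through F₂; analogously for the focus pair G₁, G₂. -/
theorem stmt8 (a b : ℝ) (ha : 0 < a) (hb : 0 < b)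
    (p1 p2 : ℝ) (hp : p1 ^ 2 / a + p2 ^ 2 / b = 1)
    (hnl : p1 ^ 2 / a ^ 2 ≠ p2 ^ 2 / b ^ 2) :
    ((p1 / a) ^ 2 - (-(p2 / b)) ^ 2 ≠ 0) ∧
    (∃ t : ℝ,
      (-Real.sqrt (a + b) =
          p1 + t * ((p1 - Real.sqrt (a + b)) -
            2 * (((p1 - Real.sqrt (a + b)) * (p1 / a) - p2 * (-(p2 / b))) /
                  ((p1 / a) ^ 2 - (-(p2 / b)) ^ 2)) * (p1 / a))) ∧
      ((0 : ℝ) =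
          p2 + t * (p2 -
            2 * (((p1 - Real.sqrt (a + b)) * (p1 / a) - p2 * (-(p2 / b))) /
                  ((p1 / a) ^ 2 - (-(p2 / b)) ^ 2)) * (-(p2 / b))))) ∧
    (∃ t : ℝ,
      ((0 : ℝ) =
          p1 + t * (p1 -
            2 * ((p1 * (p1 / a) - (p2 - Real.sqrt (a + b)) * (-(p2 / b))) /
                  ((p1 / a) ^ 2 - (-(p2 / b)) ^ 2)) * (p1 / a))) ∧
      (-Real.sqrt (a + b) =
          p2 + t * ((p2 - Real.sqrt (a + b)) -
            2 * ((p1 * (p1 / a) - (p2 - Real.sqrt (a + b)) * (-(p2 / b))) /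
                  ((p1 / a) ^ 2 - (-(p2 / b)) ^ 2)) * (-(p2 / b))))) := by
  have hc : Real.sqrt (a + b) ^ 2 = a + b := Real.sq_sqrt (by positivity)
  have hn : (p1 / a) ^ 2 - (p2 / b) ^ 2 ≠ 0 := by
    rwa [div_pow, div_pow, sub_ne_zero]
  have hn' : (p2 / b) ^ 2 - (p1 / a) ^ 2 ≠ 0 := by
    rwa [← neg_sub, neg_ne_zero]
  refine ⟨by rwa [neg_sq], ?_, ?_⟩
  · simpa only [neg_sq, mul_neg, sub_neg_eq_add] using
      exists_other_focus_eq_add_mul_reflection ha.ne' hb.ne' hc hp hn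
  · obtain ⟨t, h₂, h₁⟩ := exists_other_focus_eq_add_mul_reflection hb.ne' ha.ne'
      (by rw [hc, add_comm]) (by rw [add_comm, hp]) hn'
    rw [← neg_sub ((p1 / a) ^ 2), div_neg, add_comm (_ * (p2 / b))] at h₁ h₂
    refine ⟨t, ?_, ?_⟩ <;> simp only [neg_sq, mul_neg, sub_neg_eq_add]
    · exact h₁.trans (by ring)
    · exact h₂.trans (by ring)
end

section
/- Let n ≥ 6 be an even integer. The number of distinct ratios of the axes of ellipses having n-periodic light-like billiard trajectories — precisely, the cardinality of the set { min( tan²(kπ/n), 1/tan²(kπ/n) ) : k ∈ ℕ, 1 ≤ k < n/2, gcd(k, n/2) = 1 } — equals φ(n)/2 if n is not divisible by 4, and φ(n)/4 if n is divisible by 4, where φ is Euler's totient function. -/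
/-- The axis ratio, normalised to be at most `1`, of the ellipse with angle `kπ/n`. -/
noncomputable def axisRatio (n k : ℕ) : ℝ :=
  min (Real.tan ((k : ℝ) * Real.pi / n) ^ 2) (1 / Real.tan ((k : ℝ) * Real.pi / n) ^ 2)

theorem axisRatio_sub {m k : ℕ} (hm : 0 < m) (hk : k ≤ m) :
    axisRatio (2 * m) (m - k) = axisRatio (2 * m) k := by
  have hm' : (m : ℝ) ≠ 0 := by positivity
  have h : ((m - k : ℕ) : ℝ) * Real.pi / (2 * m : ℕ)
      = Real.pi / 2 - (k : ℝ) * Real.pi / (2 * m : ℕ) := by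
    push_cast [hk]
    field_simp
  unfold axisRatio
  rw [h, Real.tan_pi_div_two_sub, min_comm]
  simp only [inv_pow, one_div, inv_inv]

theorem angle_lt_pi_div_four {m k : ℕ} (hk : 2 * k < m) :
    (k : ℝ) * Real.pi / (2 * m : ℕ) < Real.pi / 4 := by
  have hm : (0 : ℝ) < m := by exact_mod_cast (by omega : 0 < m)
  have hk' : (2 : ℝ) * k < m := by exact_mod_cast hk
  push_cast
  rw [div_lt_div_iff₀ (by positivity) (by norm_num)]
  nlinarith [Real.pi_pos]

theorem tan_angle_nonneg {m k : ℕ} (hk : 2 * k < m) :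
    0 ≤ Real.tan ((k : ℝ) * Real.pi / (2 * m : ℕ)) :=
  Real.tan_nonneg_of_nonneg_of_le_pi_div_two (by positivity)
    (by linarith [angle_lt_pi_div_four hk, Real.pi_pos])

theorem axisRatio_eq_tan_sq {m k : ℕ} (hk0 : 0 < k) (hk : 2 * k < m) :
    axisRatio (2 * m) k = Real.tan ((k : ℝ) * Real.pi / (2 * m : ℕ)) ^ 2 := by
  have hlt := angle_lt_pi_div_four hk
  have hm : 0 < m := by omega
  have hpos : 0 < Real.tan ((k : ℝ) * Real.pi / (2 * m : ℕ)) :=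
    Real.tan_pos_of_pos_of_lt_pi_div_two (by positivity) (by linarith [Real.pi_pos])
  have hle : Real.tan ((k : ℝ) * Real.pi / (2 * m : ℕ)) < 1 := by
    rw [← Real.tan_pi_div_four]
    exact Real.tan_lt_tan_of_nonneg_of_lt_pi_div_two (by positivity)
      (by linarith [Real.pi_pos]) hlt
  have hsq : Real.tan ((k : ℝ) * Real.pi / (2 * m : ℕ)) ^ 2 ≤ 1 := by nlinarith
  exact min_eq_left (hsq.trans ((one_le_div (by positivity)).2 hsq))

theorem axisRatio_injOn (m : ℕ) :
    Set.InjOn (axisRatio (2 * m)) {k | 0 < k ∧ 2 * k < m} := by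
  rintro a ⟨ha0, ha⟩ b ⟨hb0, hb⟩ hab
  have hm : (m : ℝ) ≠ 0 := by exact_mod_cast (by omega : m ≠ 0)
  rw [axisRatio_eq_tan_sq ha0 ha, axisRatio_eq_tan_sq hb0 hb,
    sq_eq_sq₀ (tan_angle_nonneg ha) (tan_angle_nonneg hb)] at hab
  have mem {k : ℕ} (hk : 2 * k < m) :
      (k : ℝ) * Real.pi / (2 * m : ℕ) ∈ Set.Ioo (-(Real.pi / 2)) (Real.pi / 2) := by
    have h0 : 0 ≤ (k : ℝ) * Real.pi / (2 * m : ℕ) := by positivity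
    constructor <;> linarith [angle_lt_pi_div_four hk, Real.pi_pos]
  have h := Real.injOn_tan (mem ha) (mem hb) hab
  push_cast at h
  field_simp at h
  exact_mod_cast h

theorem two_mul_ne_of_coprime {m k : ℕ} (hm : 3 ≤ m) (hk : Nat.gcd k m = 1) : 2 * k ≠ m := by
  rintro rfl
  rw [Nat.gcd_mul_left_right] at hk
  omega

theorem gcd_sub_self_left_eq {m k : ℕ} (hk : k ≤ m) : Nat.gcd (m - k) m = Nat.gcd k m := by
  rw [Nat.gcd_comm, Nat.gcd_self_sub_right hk, Nat.gcd_comm]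

theorem totient_eq_two_mul_card_lower_half {m : ℕ} (hm : 3 ≤ m) :
    Nat.totient m
      = 2 * ((Finset.range m).filter (fun k => Nat.gcd k m = 1 ∧ 2 * k < m)).card := by
  have hupper : ((Finset.range m).filter (fun k => Nat.gcd k m = 1 ∧ ¬ 2 * k < m)).card
      = ((Finset.range m).filter (fun k => Nat.gcd k m = 1 ∧ 2 * k < m)).card := by
    refine Finset.card_nbij' (fun k => m - k) (fun k => m - k) ?_ ?_ ?_ ?_
    · intro k hk
      simp only [Finset.coe_filter, Finset.mem_range, Set.mem_ofPred_eq] at hk ⊢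
      have := two_mul_ne_of_coprime hm hk.2.1
      exact ⟨by omega, (gcd_sub_self_left_eq hk.1.le).trans hk.2.1, by omega⟩
    · intro k hk
      simp only [Finset.coe_filter, Finset.mem_range, Set.mem_ofPred_eq] at hk ⊢
      have : k ≠ 0 := by
        rintro rfl
        simp at hk
        omega
      exact ⟨by omega, (gcd_sub_self_left_eq hk.1.le).trans hk.2.1, by omega⟩
    all_goals
      intro k hk
      simp only [Finset.coe_filter, Finset.mem_range, Set.mem_ofPred_eq] at hk
      exact Nat.sub_sub_self hk.1.le
  have hsplit := Finset.card_filter_add_card_filter_not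
    (s := (Finset.range m).filter (fun k => Nat.gcd k m = 1)) (fun k => 2 * k < m)
  rw [Finset.filter_filter, Finset.filter_filter, hupper] at hsplit
  rw [two_mul, hsplit, Nat.totient_eq_card_coprime]
  simp only [Nat.Coprime, Nat.gcd_comm]

theorem image_axisRatio_eq {m : ℕ} (hm : 3 ≤ m) :
    ((Finset.range m).filter (fun k => 1 ≤ k ∧ Nat.gcd k m = 1)).image (axisRatio (2 * m))
      = ((Finset.range m).filter (fun k => Nat.gcd k m = 1 ∧ 2 * k < m)).image
          (axisRatio (2 * m)) := by
  ext x
  simp only [Finset.mem_image, Finset.mem_filter, Finset.mem_range]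
  constructor
  · rintro ⟨k, ⟨hkm, hk1, hg⟩, rfl⟩
    by_cases h : 2 * k < m
    · exact ⟨k, ⟨hkm, hg, h⟩, rfl⟩
    · have := two_mul_ne_of_coprime hm hg
      exact ⟨m - k, ⟨by omega, (gcd_sub_self_left_eq hkm.le).trans hg, by omega⟩,
        axisRatio_sub (by omega) hkm.le⟩
  · rintro ⟨k, ⟨hkm, hg, -⟩, rfl⟩
    refine ⟨k, ⟨hkm, Nat.one_le_iff_ne_zero.2 ?_, hg⟩, rfl⟩
    rintro rfl
    simp at hg
    omega

theorem two_mul_card_image_axisRatio {m : ℕ} (hm : 3 ≤ m) :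
    2 * (((Finset.range m).filter (fun k => 1 ≤ k ∧ Nat.gcd k m = 1)).image
      (axisRatio (2 * m))).card = Nat.totient m := by
  rw [image_axisRatio_eq hm, totient_eq_two_mul_card_lower_half hm, Finset.card_image_of_injOn]
  refine (axisRatio_injOn m).mono fun k hk => ?_
  simp only [Finset.coe_filter, Finset.mem_range, Set.mem_ofPred_eq] at hk ⊢
  refine ⟨Nat.pos_of_ne_zero ?_, hk.2.2⟩
  rintro rfl
  simp at hk
  omega


/- STATEMENT 10: for even n ≥ 6, the number of distinct axis ratios of ellipses having
n-periodic light-like billiard trajectories, i.e. the cardinality of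
{ min(tan²(kπ/n), 1/tan²(kπ/n)) : 1 ≤ k < n/2, gcd(k, n/2) = 1 },
equals φ(n)/2 if 4 ∤ n and φ(n)/4 if 4 ∣ n. -/
theorem stmt10 (n : ℕ) (hn : 6 ≤ n) (hev : Even n) :
    (((Finset.range (n / 2)).filter (fun k => 1 ≤ k ∧ Nat.gcd k (n / 2) = 1)).image
        (fun k : ℕ => min (Real.tan ((k : ℝ) * Real.pi / n) ^ 2)
          (1 / Real.tan ((k : ℝ) * Real.pi / n) ^ 2))).card
      = if 4 ∣ n then Nat.totient n / 4 else Nat.totient n / 2 := by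
  obtain ⟨m, rfl⟩ := hev.two_dvd
  have hcard := two_mul_card_image_axisRatio (m := m) (by omega)
  rw [Nat.mul_div_cancel_left m two_pos]
  change (((Finset.range m).filter (fun k => 1 ≤ k ∧ Nat.gcd k m = 1)).image
    (axisRatio (2 * m))).card = _
  split_ifs with h4
  · rw [Nat.totient_mul_of_prime_of_dvd Nat.prime_two (by omega)]
    omega
  · rw [Nat.totient_mul_of_prime_of_not_dvd Nat.prime_two (by omega)]
    omega
end

section
/- Let λ ∈ ℝ \ {a, b, −c} and let p = (x₀, y₀, z₀) ∈ Q_λ. Let T = { v ∈ ℝ³ : v₁x₀/(a−λ) + v₂y₀/(b−λ) + v₃z₀/(c+λ) = 0 } be the tangent plane directions of Q_λ at p (a two-dimensional subspace, since p ∈ Q_λ forces the defining linear form to be nonzero). Then the restriction of the Minkowski scalar product ⟨·,·⟩ to T is degenerate (i.e. there exists v ∈ T, v ≠ 0, with ⟨v, w⟩ = 0 for all w ∈ T) if and only if x₀²/(a−λ)² + y₀²/(b−λ)² − z₀²/(c+λ)² = 0. -/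
/-- A plane with Euclidean normal `(X, Y, Z)` is degenerate for the Minkowski scalar product
iff its normal is isotropic. -/
theorem minkowski_degenerate_on_plane_iff {X Y Z : ℝ} (hn : ¬(X = 0 ∧ Y = 0 ∧ Z = 0)) :
    (∃ v : ℝ × ℝ × ℝ, v ≠ 0 ∧ v.1 * X + v.2.1 * Y + v.2.2 * Z = 0 ∧
        ∀ w : ℝ × ℝ × ℝ, w.1 * X + w.2.1 * Y + w.2.2 * Z = 0 →
          v.1 * w.1 + v.2.1 * w.2.1 - v.2.2 * w.2.2 = 0) ↔
      X ^ 2 + Y ^ 2 - Z ^ 2 = 0 := by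
  constructor
  · rintro ⟨⟨p, q, r⟩, hv, ht, h⟩
    have hxy := h (Y, -X, 0) (by ring)
    have hxz := h (Z, 0, -X) (by ring)
    have hyz := h (0, Z, -Y) (by ring)
    dsimp only at ht hxy hxz hyz
    by_contra hq
    have hp : p * (X ^ 2 + Y ^ 2 - Z ^ 2) = 0 := by
      linear_combination X * ht + Y * hxy - Z * hxz
    have hq' : q * (X ^ 2 + Y ^ 2 - Z ^ 2) = 0 := by
      linear_combination Y * ht - X * hxy - Z * hyz
    have hr : r * (X ^ 2 + Y ^ 2 - Z ^ 2) = 0 := by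
      linear_combination -Z * ht + X * hxz + Y * hyz
    refine hv ?_
    rw [(mul_eq_zero.1 hp).resolve_right hq, (mul_eq_zero.1 hq').resolve_right hq,
      (mul_eq_zero.1 hr).resolve_right hq]
    rfl
  · intro h
    refine ⟨(X, Y, -Z), fun h0 => hn ?_, ?_, fun w hw => ?_⟩
    · simpa using h0
    · linear_combination h
    · linear_combination hw

/- STATEMENT 11: for p = (x₀,y₀,z₀) on the quadric Q_λ, the restriction of the Minkowski
scalar product to the tangent plane directions T of Q_λ at p is degenerate iff
x₀²/(a−λ)² + y₀²/(b−λ)² − z₀²/(c+λ)² = 0 (i.e. iff p is on a tropic curve). -/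
theorem stmt11 (a b c lam : ℝ) (hab : b < a) (hb : 0 < b) (hc : 0 < c)
    (h1 : lam ≠ a) (h2 : lam ≠ b) (h3 : lam ≠ -c)
    (x0 y0 z0 : ℝ)
    (hp : x0 ^ 2 / (a - lam) + y0 ^ 2 / (b - lam) + z0 ^ 2 / (c + lam) = 1) :
    (∃ v : ℝ × ℝ × ℝ, v ≠ 0 ∧
        (v.1 * x0 / (a - lam) + v.2.1 * y0 / (b - lam) + v.2.2 * z0 / (c + lam) = 0) ∧
        ∀ w : ℝ × ℝ × ℝ,
          (w.1 * x0 / (a - lam) + w.2.1 * y0 / (b - lam) + w.2.2 * z0 / (c + lam) = 0) →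
          v.1 * w.1 + v.2.1 * w.2.1 - v.2.2 * w.2.2 = 0) ↔
      x0 ^ 2 / (a - lam) ^ 2 + y0 ^ 2 / (b - lam) ^ 2 - z0 ^ 2 / (c + lam) ^ 2 = 0 := by
  have hn : ¬(x0 / (a - lam) = 0 ∧ y0 / (b - lam) = 0 ∧ z0 / (c + lam) = 0) := by
    rintro ⟨hx, hy, hz⟩
    have : x0 * (x0 / (a - lam)) + y0 * (y0 / (b - lam)) + z0 * (z0 / (c + lam)) = 1 := by
      rw [← hp]; ring
    simp [hx, hy, hz] at this
  simpa only [mul_div_assoc, div_pow] using minkowski_degenerate_on_plane_iff hn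
end

section
/- For every λ ∈ ℝ \ {a, b, −c}: a point p ∈ ℝ³ satisfies both x²/(a−λ) + y²/(b−λ) + z²/(c+λ) = 1 and x²/(a−λ)² + y²/(b−λ)² − z²/(c+λ)² = 0 (i.e. p lies on the tropic curves of Q_λ) if and only if p = r₊(λ, t) or p = r₋(λ, t) for some t ∈ ℝ. Moreover: (i) for each fixed t, the maps λ ↦ r±(λ,t) are affine in λ, namely r±(λ,t) = r±(0,t) + λ·w±(t) with w±(t) = (−cos t/√(a+c), −sin t/√(b+c), ±g(t)), and each direction w±(t) is light-like (⟨w±(t), w±(t)⟩ = 0), so Σ₊ and Σ₋ are ruled surfaces all of whose generatrices are light-like lines; (ii) Σ₊ ∩ Σ₋ = {(x, y, 0) : x²/(a+c) + y²/(b+c) = 1}. -/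
theorem exists_cos_sin_eq {u v : ℝ} (h : u ^ 2 + v ^ 2 = 1) :
    ∃ t : ℝ, Real.cos t = u ∧ Real.sin t = v := by
  have hn : ‖(⟨u, v⟩ : ℂ)‖ = 1 := by
    rw [Complex.norm_def, Complex.normSq_mk, Real.sqrt_eq_one]
    linarith
  refine ⟨Complex.arg ⟨u, v⟩, ?_, ?_⟩
  · simpa [hn] using Complex.norm_mul_cos_arg (⟨u, v⟩ : ℂ)
  · simpa [hn] using Complex.norm_mul_sin_arg (⟨u, v⟩ : ℂ)

/-- Two monic real cubics with double roots `l` and `m` which agree have `l = m`. -/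
theorem double_root_unique {l m n k : ℝ}
    (h : ∀ s : ℝ, (s - l) ^ 2 * (s - n) = (s - m) ^ 2 * (s - k)) : l = m := by
  by_contra hne
  have hd : l - m ≠ 0 := sub_ne_zero.mpr hne
  have h₁ : (l - m) ^ 2 * (l - k) = 0 := by rw [← h l]; ring
  have h₂ : (m - l) ^ 2 * (m - n) = 0 := by rw [h m]; ring
  have hk : k = l := by
    have := (mul_eq_zero.mp h₁).resolve_left (pow_ne_zero 2 hd)
    linarith
  have hn : n = m := by
    have := (mul_eq_zero.mp h₂).resolve_left (pow_ne_zero 2 (sub_ne_zero.mpr (Ne.symm hne)))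
    linarith
  subst hk hn
  have h₃ := h (2 * k - n)
  have : (k - n) ^ 3 = 0 := by linear_combination -h₃ / 2
  exact hd (pow_eq_zero_iff (by norm_num) |>.mp this)

/-- The equation of `Q_s` with denominators cleared, evaluated at a point of the tropic curves of
`Q_l`, has `l` as a double root in `s`. -/
theorem tropic_cubic {a b c l C S x y z : ℝ} (hac : 0 < a + c) (hbc : 0 < b + c)
    (hCS : S ^ 2 + C ^ 2 = 1)
    (hx : x ^ 2 = (a - l) ^ 2 * (C ^ 2 / (a + c)))
    (hy : y ^ 2 = (b - l) ^ 2 * (S ^ 2 / (b + c)))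
    (hz : z ^ 2 = (c + l) ^ 2 * (C ^ 2 / (a + c) + S ^ 2 / (b + c))) (s : ℝ) :
    (s - l) ^ 2 * (s - (a * S ^ 2 + b * C ^ 2)) =
      (a - s) * (b - s) * (c + s) - x ^ 2 * (b - s) * (c + s) - y ^ 2 * (a - s) * (c + s)
        - z ^ 2 * (a - s) * (b - s) := by
  have hS : S ^ 2 = 1 - C ^ 2 := by linarith
  rw [hx, hy, hz, hS]
  field_simp
  ring

/- STATEMENT 12: for λ ∉ {a,b,−c}, a point lies on the tropic curves of Q_λ iff it is
r₊(λ,t) or r₋(λ,t) for some t; the maps λ ↦ r±(λ,t) are affine with light-like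
directions w±(t) (so Σ₊, Σ₋ are ruled by light-like lines); and
Σ₊ ∩ Σ₋ = {(x,y,0) : x²/(a+c) + y²/(b+c) = 1}. -/
theorem stmt12 (a b c : ℝ) (hab : b < a) (hb : 0 < b) (hc : 0 < c)
    (g : ℝ → ℝ)
    (hg : ∀ t, g t = Real.sqrt (Real.cos t ^ 2 / (a + c) + Real.sin t ^ 2 / (b + c)))
    (rp rm : ℝ → ℝ → ℝ × ℝ × ℝ)
    (hrp : ∀ lam t, rp lam t =
      ((a - lam) * Real.cos t / Real.sqrt (a + c),
       (b - lam) * Real.sin t / Real.sqrt (b + c),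
       (c + lam) * g t))
    (hrm : ∀ lam t, rm lam t =
      ((a - lam) * Real.cos t / Real.sqrt (a + c),
       (b - lam) * Real.sin t / Real.sqrt (b + c),
       -((c + lam) * g t)))
    (wp wm : ℝ → ℝ × ℝ × ℝ)
    (hwp : ∀ t, wp t = (-(Real.cos t / Real.sqrt (a + c)),
                        -(Real.sin t / Real.sqrt (b + c)), g t))
    (hwm : ∀ t, wm t = (-(Real.cos t / Real.sqrt (a + c)),
                        -(Real.sin t / Real.sqrt (b + c)), -g t)) :
    (∀ lam : ℝ, lam ≠ a → lam ≠ b → lam ≠ -c →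
      ∀ p : ℝ × ℝ × ℝ,
        (p.1 ^ 2 / (a - lam) + p.2.1 ^ 2 / (b - lam) + p.2.2 ^ 2 / (c + lam) = 1 ∧
         p.1 ^ 2 / (a - lam) ^ 2 + p.2.1 ^ 2 / (b - lam) ^ 2 - p.2.2 ^ 2 / (c + lam) ^ 2 = 0)
        ↔ (∃ t : ℝ, p = rp lam t ∨ p = rm lam t)) ∧
    (∀ lam t : ℝ,
      rp lam t = rp 0 t + lam • wp t ∧ rm lam t = rm 0 t + lam • wm t) ∧
    (∀ t : ℝ, (wp t).1 ^ 2 + (wp t).2.1 ^ 2 - (wp t).2.2 ^ 2 = 0 ∧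
              (wm t).1 ^ 2 + (wm t).2.1 ^ 2 - (wm t).2.2 ^ 2 = 0) ∧
    ({p : ℝ × ℝ × ℝ | ∃ lam t : ℝ, p = rp lam t} ∩
       {p : ℝ × ℝ × ℝ | ∃ lam t : ℝ, p = rm lam t}
      = {p : ℝ × ℝ × ℝ | p.2.2 = 0 ∧ p.1 ^ 2 / (a + c) + p.2.1 ^ 2 / (b + c) = 1}) := by
  have hac : 0 < a + c := by linarith
  have hbc : 0 < b + c := by linarith
  have hsa := Real.sq_sqrt hac.le
  have hsb := Real.sq_sqrt hbc.le
  have hg2 (t : ℝ) : g t ^ 2 = Real.cos t ^ 2 / (a + c) + Real.sin t ^ 2 / (b + c) := by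
    rw [hg]
    exact Real.sq_sqrt (by positivity)
  have hgpos (t : ℝ) : 0 < g t := by
    refine lt_of_le_of_ne (by rw [hg]; positivity) fun h0 => ?_
    have h := hg2 t
    rw [← h0] at h
    have h₁ : 0 ≤ Real.cos t ^ 2 / (a + c) := by positivity
    have h₂ : 0 ≤ Real.sin t ^ 2 / (b + c) := by positivity
    have hc0 : Real.cos t ^ 2 / (a + c) = 0 := by linarith
    have hs0 : Real.sin t ^ 2 / (b + c) = 0 := by linarith
    rw [div_eq_zero_iff] at hc0 hs0
    linarith [Real.sin_sq_add_cos_sq t, hc0.resolve_right hac.ne', hs0.resolve_right hbc.ne']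
  have hx2 (l t : ℝ) : ((a - l) * Real.cos t / √(a + c)) ^ 2
      = (a - l) ^ 2 * (Real.cos t ^ 2 / (a + c)) := by
    rw [div_pow, hsa]; ring
  have hy2 (l t : ℝ) : ((b - l) * Real.sin t / √(b + c)) ^ 2
      = (b - l) ^ 2 * (Real.sin t ^ 2 / (b + c)) := by
    rw [div_pow, hsb]; ring
  have hz2 (l t : ℝ) : ((c + l) * g t) ^ 2
      = (c + l) ^ 2 * (Real.cos t ^ 2 / (a + c) + Real.sin t ^ 2 / (b + c)) := by
    rw [mul_pow, hg2]
  refine ⟨?_, ?_, ?_, ?_⟩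
  · rintro l hla hlb hlc ⟨x, y, z⟩
    have ha0 : a - l ≠ 0 := sub_ne_zero.mpr hla.symm
    have hb0 : b - l ≠ 0 := sub_ne_zero.mpr hlb.symm
    have hc0 : c + l ≠ 0 := fun h => hlc (by linarith)
    simp only [hrp, hrm, Prod.mk.injEq]
    constructor
    · rintro ⟨h₁, h₂⟩
      obtain ⟨X, rfl⟩ : ∃ X, x = (a - l) * X := ⟨x / (a - l), by field_simp⟩
      obtain ⟨Y, rfl⟩ : ∃ Y, y = (b - l) * Y := ⟨y / (b - l), by field_simp⟩
      obtain ⟨Z, rfl⟩ : ∃ Z, z = (c + l) * Z := ⟨z / (c + l), by field_simp⟩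
      have h₃ : X ^ 2 + Y ^ 2 - Z ^ 2 = 0 := by
        rw [← h₂]; field_simp
      have h₄ : (a - l) * X ^ 2 + (b - l) * Y ^ 2 + (c + l) * Z ^ 2 = 1 := by
        rw [← h₁]; field_simp
      obtain ⟨t, hct, hst⟩ := exists_cos_sin_eq (u := √(a + c) * X) (v := √(b + c) * Y) (by
        rw [mul_pow, mul_pow, hsa, hsb]
        linear_combination h₄ + (c + l) * h₃)
      have hZ : Z ^ 2 = g t ^ 2 := by
        rw [hg2, hct, hst, mul_pow, mul_pow, hsa, hsb]
        field_simp
        linarith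
      refine ⟨t, ?_⟩
      rw [hct, hst]
      rcases sq_eq_sq_iff_eq_or_eq_neg.mp hZ with h | h
      · exact Or.inl ⟨by field_simp, by field_simp, by rw [h]⟩
      · exact Or.inr ⟨by field_simp, by field_simp, by rw [h]; ring⟩
    · rintro ⟨t, ht⟩
      have hx : x ^ 2 = (a - l) ^ 2 * (Real.cos t ^ 2 / (a + c)) := by
        rcases ht with h | h <;> rw [h.1, hx2]
      have hy : y ^ 2 = (b - l) ^ 2 * (Real.sin t ^ 2 / (b + c)) := by
        rcases ht with h | h <;> rw [h.2.1, hy2]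
      have hz : z ^ 2 = (c + l) ^ 2 * (Real.cos t ^ 2 / (a + c) + Real.sin t ^ 2 / (b + c)) := by
        rcases ht with h | h
        · rw [h.2.2, hz2]
        · rw [h.2.2, neg_sq, hz2]
      have hS : Real.sin t ^ 2 = 1 - Real.cos t ^ 2 := Real.sin_sq t
      simp only [hx, hy, hz, hS]
      constructor
      · field_simp
        ring
      · field_simp
        ring
  · intro l t
    simp only [hrp, hrm, hwp, hwm, Prod.smul_mk, Prod.mk_add_mk, smul_eq_mul, Prod.mk.injEq]
    refine ⟨⟨?_, ?_, ?_⟩, ?_, ?_, ?_⟩ <;> ring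
  · intro t
    simp only [hwp, hwm, neg_sq, hg2, div_pow, hsa, hsb, sub_self, and_self]
  · ext ⟨x, y, z⟩
    simp only [Set.mem_inter_iff, Set.mem_ofPred_eq, hrp, hrm, Prod.mk.injEq]
    constructor
    · rintro ⟨⟨l, t, hx, hy, hz⟩, m, s, hx', hy', hz'⟩
      have hlm : l = m := double_root_unique fun r =>
        (tropic_cubic (x := x) (y := y) (z := z) hac hbc (Real.sin_sq_add_cos_sq t)
          (by rw [hx, hx2]) (by rw [hy, hy2]) (by rw [hz, hz2]) r).trans
        (tropic_cubic hac hbc (Real.sin_sq_add_cos_sq s)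
          (by rw [hx', hx2]) (by rw [hy', hy2]) (by rw [hz', neg_sq, hz2]) r).symm
      subst hlm
      have hl : (c + l) * (g t + g s) = 0 := by linarith
      have hl0 : c + l = 0 :=
        (mul_eq_zero.mp hl).resolve_right (add_pos (hgpos t) (hgpos s)).ne'
      obtain rfl : l = -c := by linarith
      refine ⟨by rw [hz]; ring, ?_⟩
      rw [hx, hy, hx2, hy2, ← Real.cos_sq_add_sin_sq t]
      field_simp
      ring
    · rintro ⟨rfl, h⟩
      obtain ⟨t, hct, hst⟩ := exists_cos_sin_eq (u := x / √(a + c)) (v := y / √(b + c)) (by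
        rw [div_pow, div_pow, hsa, hsb, h])
      have hx : x = (a - -c) * Real.cos t / √(a + c) := by
        rw [hct, sub_neg_eq_add]
        field_simp
        rw [hsa]
      have hy : y = (b - -c) * Real.sin t / √(b + c) := by
        rw [hst, sub_neg_eq_add]
        field_simp
        rw [hsb]
      exact ⟨⟨-c, t, hx, hy, by ring⟩, -c, t, hx, hy, by ring⟩
end

section
/- For all (λ, t) ∈ ℝ², the Euclidean cross product n(λ,t) = ∂_λ r₊(λ,t) × ∂_t r₊(λ,t) satisfies n₁² + n₂² = n₃²; that is, the pseudo-normal E_{2,1}·n of the surface Σ₊ is light-like at every point, so the Minkowski Gauss map of Σ₊ is singular everywhere. The same holds for r₋ and Σ₋. -/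
/-- If `x` is Minkowski light-like and Minkowski orthogonal to `y`, then the Euclidean cross product
`x × y` is light-like. -/
theorem cross_lightlike_of_orthogonal {x₁ x₂ x₃ y₁ y₂ y₃ : ℝ}
    (hx : x₁ ^ 2 + x₂ ^ 2 - x₃ ^ 2 = 0) (hxy : x₁ * y₁ + x₂ * y₂ - x₃ * y₃ = 0) :
    (x₂ * y₃ - x₃ * y₂) ^ 2 + (x₃ * y₁ - x₁ * y₃) ^ 2 = (x₁ * y₂ - x₂ * y₁) ^ 2 := by
  linear_combination (x₁ * y₁ + x₂ * y₂ - x₃ * y₃) * hxy - (y₁ ^ 2 + y₂ ^ 2 - y₃ ^ 2) * hx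

/-- The radicand defining `g` is positive. -/
theorem cos_sq_div_add_sin_sq_div_pos {A B : ℝ} (hA : 0 < A) (hB : 0 < B) (t : ℝ) :
    0 < Real.cos t ^ 2 / A + Real.sin t ^ 2 / B := by
  rcases eq_or_ne (Real.cos t) 0 with h | h
  · have hs : Real.sin t ^ 2 = 1 := by simpa [h] using Real.sin_sq_add_cos_sq t
    rw [h, hs]
    positivity
  · positivity

theorem hasDerivAt_sqrt_cos_sq_div_add_sin_sq_div {A B : ℝ} (hA : 0 < A) (hB : 0 < B) (t : ℝ) :
    HasDerivAt (fun s => √(Real.cos s ^ 2 / A + Real.sin s ^ 2 / B))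
      (Real.cos t * Real.sin t * (1 / B - 1 / A) /
        √(Real.cos t ^ 2 / A + Real.sin t ^ 2 / B)) t := by
  have h := ((((Real.hasDerivAt_cos t).pow 2).div_const A).add
    (((Real.hasDerivAt_sin t).pow 2).div_const B)).sqrt
      (cos_sq_div_add_sin_sq_div_pos hA hB t).ne'
  refine h.congr_deriv ?_
  simp only [Pi.add_apply, Pi.pow_apply]
  have hg := (Real.sqrt_pos.2 (cos_sq_div_add_sin_sq_div_pos hA hB t)).ne'
  field_simp
  ring

/- STATEMENT 13: the Euclidean cross product n = ∂_λ r± × ∂_t r± satisfies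
n₁² + n₂² = n₃², i.e. the pseudo-normal E_{2,1}·n of Σ± is light-like everywhere, so
the Minkowski Gauss map of Σ± is singular at all points. The sign parameter `sgn`
covers both r₊ and r₋. -/
theorem stmt13 (a b c : ℝ) (hab : b < a) (hb : 0 < b) (hc : 0 < c)
    (g : ℝ → ℝ)
    (hg : ∀ t, g t = Real.sqrt (Real.cos t ^ 2 / (a + c) + Real.sin t ^ 2 / (b + c)))
    (sgn : ℝ) (hsgn : sgn = 1 ∨ sgn = -1)
    (r : ℝ → ℝ → ℝ × ℝ × ℝ)
    (hr : ∀ lam t, r lam t =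
      ((a - lam) * Real.cos t / Real.sqrt (a + c),
       (b - lam) * Real.sin t / Real.sqrt (b + c),
       sgn * ((c + lam) * g t)))
    (lam t : ℝ) :
    letI dl : ℝ × ℝ × ℝ :=
      (deriv (fun s => (r s t).1) lam, deriv (fun s => (r s t).2.1) lam,
        deriv (fun s => (r s t).2.2) lam)
    letI dt : ℝ × ℝ × ℝ :=
      (deriv (fun s => (r lam s).1) t, deriv (fun s => (r lam s).2.1) t,
        deriv (fun s => (r lam s).2.2) t)
    letI n : ℝ × ℝ × ℝ :=
      (dl.2.1 * dt.2.2 - dl.2.2 * dt.2.1,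
       dl.2.2 * dt.1 - dl.1 * dt.2.2,
       dl.1 * dt.2.1 - dl.2.1 * dt.1)
    n.1 ^ 2 + n.2.1 ^ 2 = n.2.2 ^ 2 := by
  have hA : 0 < a + c := by linarith
  have hB : 0 < b + c := by linarith
  have hA' := (Real.sqrt_pos.2 hA).ne'
  have hB' := (Real.sqrt_pos.2 hB).ne'
  have hpos := cos_sq_div_add_sin_sq_div_pos hA hB t
  have hg0 : g t ≠ 0 := by rw [hg]; exact (Real.sqrt_pos.2 hpos).ne'
  have hg2 : g t ^ 2 = Real.cos t ^ 2 / (a + c) + Real.sin t ^ 2 / (b + c) := by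
    rw [hg, Real.sq_sqrt hpos.le]
  have hs2 : sgn ^ 2 = 1 := by rcases hsgn with rfl | rfl <;> norm_num
  have hgd : HasDerivAt g (Real.cos t * Real.sin t * (1 / (b + c) - 1 / (a + c)) / g t) t := by
    rw [hg t, funext hg]
    exact hasDerivAt_sqrt_cos_sq_div_add_sin_sq_div hA hB t
  have l₁ : HasDerivAt (fun s => (r s t).1) (-Real.cos t / √(a + c)) lam := by
    simp only [hr]
    simpa using (((hasDerivAt_id lam).const_sub a).mul_const (Real.cos t)).div_const √(a + c)
  have l₂ : HasDerivAt (fun s => (r s t).2.1) (-Real.sin t / √(b + c)) lam := by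
    simp only [hr]
    simpa using (((hasDerivAt_id lam).const_sub b).mul_const (Real.sin t)).div_const √(b + c)
  have l₃ : HasDerivAt (fun s => (r s t).2.2) (sgn * g t) lam := by
    simp only [hr]
    simpa using (((hasDerivAt_id lam).const_add c).mul_const (g t)).const_mul sgn
  have t₁ : HasDerivAt (fun s => (r lam s).1) ((a - lam) * -Real.sin t / √(a + c)) t := by
    simp only [hr]
    exact ((Real.hasDerivAt_cos t).const_mul (a - lam)).div_const √(a + c)
  have t₂ : HasDerivAt (fun s => (r lam s).2.1) ((b - lam) * Real.cos t / √(b + c)) t := by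
    simp only [hr]
    exact ((Real.hasDerivAt_sin t).const_mul (b - lam)).div_const √(b + c)
  have t₃ : HasDerivAt (fun s => (r lam s).2.2) (sgn * ((c + lam) *
      (Real.cos t * Real.sin t * (1 / (b + c) - 1 / (a + c)) / g t))) t := by
    simp only [hr]
    exact (hgd.const_mul (c + lam)).const_mul sgn
  simp only [l₁.deriv, l₂.deriv, l₃.deriv, t₁.deriv, t₂.deriv, t₃.deriv]
  apply cross_lightlike_of_orthogonal
  · rw [div_pow, div_pow, mul_pow, Real.sq_sqrt hA.le, Real.sq_sqrt hB.le, hs2, hg2]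
    ring
  · have e₁ : -Real.cos t / √(a + c) * ((a - lam) * -Real.sin t / √(a + c)) =
        Real.cos t * Real.sin t * (a - lam) / (a + c) := by
      rw [div_mul_div_comm, Real.mul_self_sqrt hA.le]
      ring
    have e₂ : -Real.sin t / √(b + c) * ((b - lam) * Real.cos t / √(b + c)) =
        -(Real.cos t * Real.sin t * (b - lam) / (b + c)) := by
      rw [div_mul_div_comm, Real.mul_self_sqrt hB.le]
      ring
    have e₃ : sgn * g t * (sgn * ((c + lam) *
        (Real.cos t * Real.sin t * (1 / (b + c) - 1 / (a + c)) / g t))) =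
        (c + lam) * (Real.cos t * Real.sin t * (1 / (b + c) - 1 / (a + c))) := by
      field_simp
      rw [hs2]
      ring
    rw [e₁, e₂, e₃]
    field_simp
    ring
end

section
/- Let λ₀ ∈ ℝ \ {a, b, −c} and (x, y, z) ∈ ℝ³. Define the cubic polynomial F(λ) = x²(b−λ)(c+λ) + y²(a−λ)(c+λ) + z²(a−λ)(b−λ) − (a−λ)(b−λ)(c+λ). Suppose F(λ₀) = 0 (equivalently, (x,y,z) ∈ Q_{λ₀}). Then λ₀ is a multiple root of F (i.e. F'(λ₀) = 0) if and only if x²/(a−λ₀)² + y²/(b−λ₀)² − z²/(c+λ₀)² = 0, i.e. if and only if (x, y, z) lies on a tropic curve of Q_{λ₀}. -/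
/-- The derivative of the cubic whose roots are the parameters of the confocal quadrics
through `(x, y, z)`. -/
theorem hasDerivAt_confocalCubic (a b c x y z t : ℝ) :
    HasDerivAt (fun s : ℝ => x ^ 2 * (b - s) * (c + s) + y ^ 2 * (a - s) * (c + s) +
        z ^ 2 * (a - s) * (b - s) - (a - s) * (b - s) * (c + s))
      (x ^ 2 * ((b - t) - (c + t)) + y ^ 2 * ((a - t) - (c + t)) -
        z ^ 2 * ((a - t) + (b - t)) +
        ((b - t) * (c + t) + (a - t) * (c + t) - (a - t) * (b - t))) t := by
  have hA : HasDerivAt (fun s : ℝ => a - s) (-1) t := (hasDerivAt_id' t).const_sub a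
  have hB : HasDerivAt (fun s : ℝ => b - s) (-1) t := (hasDerivAt_id' t).const_sub b
  have hC : HasDerivAt (fun s : ℝ => c + s) 1 t := (hasDerivAt_id' t).const_add c
  refine ((((((hB.const_mul (x ^ 2)).mul hC).add ((hA.const_mul (y ^ 2)).mul hC)).add
    ((hA.const_mul (z ^ 2)).mul hB)).sub ((hA.mul hB).mul hC))).congr_deriv ?_
  simp only [Pi.mul_apply]
  ring

/- STATEMENT 15: for (x,y,z) ∈ Q_{λ₀} (i.e. F(λ₀) = 0, where F is the cubic polynomial
of the confocal family), λ₀ is a multiple root of F (F'(λ₀) = 0) iff (x,y,z) lies on a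
tropic curve of Q_{λ₀}. -/
theorem stmt15 (a b c lam0 : ℝ) (hab : b < a) (hb : 0 < b) (hc : 0 < c)
    (h1 : lam0 ≠ a) (h2 : lam0 ≠ b) (h3 : lam0 ≠ -c)
    (x y z : ℝ)
    (F : ℝ → ℝ)
    (hF : ∀ lam, F lam =
      x ^ 2 * (b - lam) * (c + lam) + y ^ 2 * (a - lam) * (c + lam) +
        z ^ 2 * (a - lam) * (b - lam) - (a - lam) * (b - lam) * (c + lam))
    (h0 : F lam0 = 0) :
    deriv F lam0 = 0 ↔
      x ^ 2 / (a - lam0) ^ 2 + y ^ 2 / (b - lam0) ^ 2 - z ^ 2 / (c + lam0) ^ 2 = 0 := by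
  have hA : a - lam0 ≠ 0 := sub_ne_zero.mpr h1.symm
  have hB : b - lam0 ≠ 0 := sub_ne_zero.mpr h2.symm
  have hC : c + lam0 ≠ 0 := fun h => h3 (by linarith)
  have hderiv := hasDerivAt_confocalCubic a b c x y z lam0
  rw [← funext hF] at hderiv
  rw [hF] at h0
  have key : deriv F lam0 = (a - lam0) * (b - lam0) * (c + lam0) *
      (x ^ 2 / (a - lam0) ^ 2 + y ^ 2 / (b - lam0) ^ 2 - z ^ 2 / (c + lam0) ^ 2) := by
    rw [hderiv.deriv]
    generalize a - lam0 = A at *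
    generalize b - lam0 = B at *
    generalize c + lam0 = C at *
    field_simp
    linear_combination (A * B - B * C - A * C) * h0
  rw [key, mul_eq_zero_iff_left (mul_ne_zero (mul_ne_zero hA hB) hC)]
end

section
/- Let λ ∈ (b, a), so Q_λ is a one-sheeted hyperboloid oriented along the y-axis. Let ℓ₁ and ℓ₂ be two distinct lines in ℝ³, each entirely contained in Q_λ and each having a light-like direction vector. If p ∈ ℓ₁ ∩ ℓ₂, then p lies on a degenerate quadric of the confocal family, i.e. p₁ = 0 or p₂ = 0 or p₃ = 0. -/
/-- If a line through `p` with direction `u` lies on the quadric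
`α x² + β y² + γ z² = 1`, then `u` is isotropic for the quadratic form and conjugate to `p`. -/
lemma isotropic_and_conjugate_of_line_subset {α β γ : ℝ} {q u p : ℝ × ℝ × ℝ}
    (hL : ∀ τ : ℝ, (q + τ • u).1 ^ 2 / α + (q + τ • u).2.1 ^ 2 / β +
      (q + τ • u).2.2 ^ 2 / γ = 1)
    (hp : ∃ τ : ℝ, p = q + τ • u) :
    u.1 ^ 2 / α + u.2.1 ^ 2 / β + u.2.2 ^ 2 / γ = 0 ∧
      p.1 * u.1 / α + p.2.1 * u.2.1 / β + p.2.2 * u.2.2 / γ = 0 := by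
  obtain ⟨t, rfl⟩ := hp
  have h₀ := hL t
  have h₁ := hL (t + 1)
  have h₂ := hL (t - 1)
  simp only [Prod.fst_add, Prod.snd_add, Prod.smul_fst, Prod.smul_snd, smul_eq_mul,
    div_eq_mul_inv] at *
  constructor
  · linear_combination (h₁ + h₂) / 2 - h₀
  · linear_combination (h₁ - h₂) / 4

/-- Two lines through a common point with proportional directions coincide. -/
lemma line_eq_of_smul_eq {V : Type*} [AddCommGroup V] [Module ℝ V] {q₁ q₂ u₁ u₂ p : V} {k : ℝ}
    (hk : k ≠ 0) (hu : u₁ = k • u₂)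
    (hp₁ : ∃ τ : ℝ, p = q₁ + τ • u₁) (hp₂ : ∃ τ : ℝ, p = q₂ + τ • u₂) :
    {x : V | ∃ τ : ℝ, x = q₁ + τ • u₁} = {x : V | ∃ τ : ℝ, x = q₂ + τ • u₂} := by
  obtain ⟨s, hs⟩ := hp₁
  obtain ⟨t, ht⟩ := hp₂
  have hq₁ : q₁ = p - s • u₁ := by rw [hs]; abel
  have hq₂ : q₂ = p - t • u₂ := by rw [ht]; abel
  subst hu hq₁ hq₂
  ext x
  constructor
  · rintro ⟨τ, rfl⟩
    exact ⟨t + (τ - s) * k, by module⟩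
  · rintro ⟨τ, rfl⟩
    refine ⟨s + (τ - t) / k, ?_⟩
    match_scalars <;> field_simp <;> ring

/-- For a direction that is both light-like and isotropic for `x²/α + y²/β + z²/γ`, where
`α, γ > 0`, the `y`-component is nonzero. -/
lemma snd_ne_zero_of_lightlike {α β γ : ℝ} (hα : 0 < α) (hγ : 0 < γ) {u : ℝ × ℝ × ℝ} (hu : u ≠ 0)
    (hl : u.1 ^ 2 + u.2.1 ^ 2 - u.2.2 ^ 2 = 0)
    (hq : u.1 ^ 2 / α + u.2.1 ^ 2 / β + u.2.2 ^ 2 / γ = 0) : u.2.1 ≠ 0 := by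
  obtain ⟨x, y, z⟩ := u
  rintro rfl
  simp only at hl hq
  have hz : z ^ 2 = x ^ 2 := by linarith
  rw [hz] at hq
  have hpos : 0 < α⁻¹ + γ⁻¹ := by positivity
  have hx : x ^ 2 * (α⁻¹ + γ⁻¹) = 0 := by linear_combination hq
  have hx0 : x ^ 2 = 0 := (mul_eq_zero.mp hx).resolve_right hpos.ne'
  rw [hx0] at hz
  exact hu (by simp [pow_eq_zero_iff two_ne_zero |>.mp hx0, pow_eq_zero_iff two_ne_zero |>.mp hz])

/- STATEMENT 17: two distinct light-like lines contained in a one-sheeted hyperboloid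
Q_λ, λ ∈ (b,a), oriented along the y-axis, intersect (if at all) only on a degenerate
quadric of the confocal family, i.e. on a coordinate plane. -/
theorem stmt17 (a b c lam : ℝ) (hab : b < a) (hb : 0 < b) (hc : 0 < c)
    (hlam : lam ∈ Set.Ioo b a)
    (q1 q2 u1 u2 p : ℝ × ℝ × ℝ)
    (hu1 : u1 ≠ 0) (hu2 : u2 ≠ 0)
    (hl1 : u1.1 ^ 2 + u1.2.1 ^ 2 - u1.2.2 ^ 2 = 0)
    (hl2 : u2.1 ^ 2 + u2.2.1 ^ 2 - u2.2.2 ^ 2 = 0)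
    (hL1 : ∀ τ : ℝ,
      (q1 + τ • u1).1 ^ 2 / (a - lam) + (q1 + τ • u1).2.1 ^ 2 / (b - lam) +
        (q1 + τ • u1).2.2 ^ 2 / (c + lam) = 1)
    (hL2 : ∀ τ : ℝ,
      (q2 + τ • u2).1 ^ 2 / (a - lam) + (q2 + τ • u2).2.1 ^ 2 / (b - lam) +
        (q2 + τ • u2).2.2 ^ 2 / (c + lam) = 1)
    (hdist : {x : ℝ × ℝ × ℝ | ∃ τ : ℝ, x = q1 + τ • u1} ≠
             {x : ℝ × ℝ × ℝ | ∃ τ : ℝ, x = q2 + τ • u2})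
    (hp1 : ∃ τ : ℝ, p = q1 + τ • u1)
    (hp2 : ∃ τ : ℝ, p = q2 + τ • u2) :
    p.1 = 0 ∨ p.2.1 = 0 ∨ p.2.2 = 0 := by
  obtain ⟨hlb, hla⟩ := hlam
  have hA : 0 < a - lam := by linarith
  have hB : b - lam ≠ 0 := (sub_neg.mpr hlb).ne
  have hC : 0 < c + lam := by linarith
  obtain ⟨hi1, hc1⟩ := isotropic_and_conjugate_of_line_subset hL1 hp1
  obtain ⟨hi2, hc2⟩ := isotropic_and_conjugate_of_line_subset hL2 hp2
  have hy1 := snd_ne_zero_of_lightlike hA hC hu1 hl1 hi1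
  have hy2 := snd_ne_zero_of_lightlike hA hC hu2 hl2 hi2
  have hnot : ¬ (u1.1 * u2.2.1 = u2.1 * u1.2.1 ∧ u1.2.2 * u2.2.1 = u2.2.2 * u1.2.1) := by
    rintro ⟨hx, hz⟩
    refine hdist (line_eq_of_smul_eq (div_ne_zero hy1 hy2) ?_ hp1 hp2)
    ext <;> simp only [Prod.smul_fst, Prod.smul_snd, smul_eq_mul] <;> field_simp <;> linarith
  clear hL1 hL2 hp1 hp2 hdist
  obtain ⟨x1, y1, z1⟩ := u1
  obtain ⟨x2, y2, z2⟩ := u2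
  obtain ⟨X, Y, Z⟩ := p
  simp only at *
  have hpos : 0 < (a - lam)⁻¹ + (c + lam)⁻¹ := by positivity
  have hx : (x1 * y2) ^ 2 = (x2 * y1) ^ 2 := by
    refine mul_right_cancel₀ hpos.ne' ?_
    linear_combination y2 ^ 2 * hi1 - y1 ^ 2 * hi2 + (y2 ^ 2 * hl1 - y1 ^ 2 * hl2) / (c + lam)
  have hz : (z1 * y2) ^ 2 = (z2 * y1) ^ 2 := by
    linear_combination hx - y2 ^ 2 * hl1 + y1 ^ 2 * hl2
  have hconj : X * (x1 * y2 - x2 * y1) / (a - lam) + Z * (z1 * y2 - z2 * y1) / (c + lam) = 0 := by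
    linear_combination y2 * hc1 - y1 * hc2
  rcases sq_eq_sq_iff_eq_or_eq_neg.mp hx with hx | hx <;>
    rcases sq_eq_sq_iff_eq_or_eq_neg.mp hz with hz | hz
  · exact absurd ⟨hx, hz⟩ hnot
  · rw [hx, sub_self, mul_zero, zero_div, zero_add, div_eq_zero_iff, mul_eq_zero] at hconj
    rcases hconj with (h | h) | h
    · exact .inr (.inr h)
    · exact absurd ⟨hx, by linarith⟩ hnot
    · exact absurd h hC.ne'
  · rw [hz, sub_self, mul_zero, zero_div, add_zero, div_eq_zero_iff, mul_eq_zero] at hconj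
    rcases hconj with (h | h) | h
    · exact .inl h
    · exact absurd ⟨by linarith, hz⟩ hnot
    · exact absurd h hA.ne'
  · have hY : Y * (y1 * y2) / (b - lam) = 0 := by
      linear_combination (y2 * hc1 + y1 * hc2) / 2 - X / (a - lam) * hx / 2 - Z / (c + lam) * hz / 2
    simp_all
end
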